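/- arXiv:1912.08017 — 4 statements merged into one kernel-verified Lean document; each statement's English description precedes it below -/
import Mathlib

section
/- Let Λ ⊆ ℝ^d be a d-dimensional lattice and let L ⊆ Λ be a primitive sublattice with respect to Λ (i.e., span(L) ∩ Λ = L). Define L^⊥ := {v ∈ Λ* : ⟨v, x⟩ = 0 for all x ∈ L}. Then det(L^⊥) = det(L) / det(Λ). -/
open scoped BigOperators

/-- The set of integer linear combinations of the vectors `v i` (the lattice they generate). -/
def zspan {d k : ℕ} (v : Fin k → Fin d → ℝ) : Set (Fin d → ℝ) :=
  {x | ∃ c : Fin k → ℤ, x = ∑ i, (c i : ℝ) • v i}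

/-- The square root of the Gram determinant of a family of vectors: the volume of the
fundamental domain of the lattice they generate (`det(BᵀB)^{1/2}`). -/
noncomputable def latDet {d k : ℕ} (v : Fin k → Fin d → ℝ) : ℝ :=
  Real.sqrt (Matrix.det (Matrix.of fun i j : Fin k => ∑ t, v i t * v j t))

/-- The dual lattice `Λ*` of a full-rank lattice `Λ ⊆ ℝ^d`:
vectors whose inner products with all lattice vectors are integers. -/
def dualLat {d : ℕ} (Λ : Set (Fin d → ℝ)) : Set (Fin d → ℝ) :=
  {y | ∀ x ∈ Λ, ∃ n : ℤ, ∑ t, x t * y t = (n : ℝ)}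

open Matrix in
theorem dpl_jacobi {ι κ : Type*} [Fintype ι] [Fintype κ] [DecidableEq ι] [DecidableEq κ]
    (G H : Matrix (ι ⊕ κ) (ι ⊕ κ) ℝ) (h : G * H = 1) :
    G.det * H.toBlocks₂₂.det = G.toBlocks₁₁.det := by
  have h1 : G * fromBlocks 1 H.toBlocks₁₂ 0 H.toBlocks₂₂
      = fromBlocks G.toBlocks₁₁ 0 G.toBlocks₂₁ 1 := by
    have h2 : G * H = fromBlocks 1 0 0 1 := by rw [h, fromBlocks_one]
    rw [← fromBlocks_toBlocks G, ← fromBlocks_toBlocks H, fromBlocks_multiply,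
      fromBlocks_inj] at h2
    obtain ⟨-, h12, -, h22⟩ := h2
    conv_lhs => rw [← fromBlocks_toBlocks G]
    rw [fromBlocks_multiply, h12, h22]
    simp
  have h3 := congrArg det h1
  rw [det_mul, det_fromBlocks_zero₂₁, det_fromBlocks_zero₁₂] at h3
  simpa using h3

open Matrix in
theorem dpl_key {α β τ : Type*} [Fintype α] [Fintype β] [DecidableEq α]
    (X : Matrix α τ ℝ) (Y : Matrix β τ ℝ) (U : Matrix α β ℤ) (V : Matrix β α ℤ)
    (hX : Function.Injective X.vecMul)
    (hU : X = U.map (Int.cast : ℤ → ℝ) * Y) (hV : Y = V.map (Int.cast : ℤ → ℝ) * X) :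
    U * V = 1 := by
  have h1 : (U * V).map (Int.cast : ℤ → ℝ) * X = (1 : Matrix α α ℝ) * X := by
    have : (U * V).map (Int.cast : ℤ → ℝ)
        = U.map (Int.cast : ℤ → ℝ) * V.map (Int.cast : ℤ → ℝ) :=
      Matrix.map_mul (f := Int.castRingHom ℝ)
    rw [this, Matrix.mul_assoc, ← hV, ← hU, Matrix.one_mul]
  have h2 : (U * V).map (Int.cast : ℤ → ℝ) = 1 := by
    funext i
    apply hX
    have := congrFun h1 i
    simpa only [Matrix.mul_apply_eq_vecMul] using this
  ext i j
  have := congrFun (congrFun h2 i) j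
  simp only [Matrix.map_apply, Matrix.one_apply] at this ⊢
  split_ifs at this ⊢ <;> exact_mod_cast this

open Matrix in
theorem dpl_gram {ι κ τ : Type*} [Fintype ι] [Fintype κ] [Fintype τ] [DecidableEq ι]
    [DecidableEq κ]
    (X : Matrix ι τ ℝ) (Y : Matrix κ τ ℝ) (U : Matrix ι κ ℤ) (V : Matrix κ ι ℤ)
    (hX : Function.Injective X.vecMul) (hY : Function.Injective Y.vecMul)
    (hU : X = U.map (Int.cast : ℤ → ℝ) * Y) (hV : Y = V.map (Int.cast : ℤ → ℝ) * X) :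
    (X * Xᵀ).det = (Y * Yᵀ).det := by
  have hUV : U * V = 1 := dpl_key X Y U V hX hU hV
  have hVU : V * U = 1 := dpl_key Y X V U hY hV hU
  have hcard : Fintype.card ι = Fintype.card κ := Matrix.square_of_invertible U V hUV hVU
  let e : ι ≃ κ := Fintype.equivOfCardEq hcard
  let U' : Matrix ι ι ℤ := U.submatrix id e
  let V' : Matrix ι ι ℤ := V.submatrix e id
  have hUV' : U' * V' = 1 := by
    simp only [U', V']
    rw [Matrix.submatrix_mul_equiv, hUV, Matrix.submatrix_id_id]
  have hu : IsUnit U'.det := by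
    apply IsUnit.of_mul_eq_one V'.det
    rw [← Matrix.det_mul, hUV', Matrix.det_one]
  have hdet : ((U'.map (Int.cast : ℤ → ℝ)).det) ^ 2 = 1 := by
    have : (U'.map (Int.cast : ℤ → ℝ)).det = (U'.det : ℝ) := (Int.cast_det U').symm
    rw [this]
    rcases Int.isUnit_iff.mp hu with h | h <;> simp [h]
  have hX' : X = U'.map (Int.cast : ℤ → ℝ) * Y.submatrix e id := by
    conv_lhs => rw [hU]
    have : U'.map (Int.cast : ℤ → ℝ) = (U.map (Int.cast : ℤ → ℝ)).submatrix id e := rfl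
    rw [this, Matrix.submatrix_mul_equiv, Matrix.submatrix_id_id]
  have hYY : (Y.submatrix e id) * (Y.submatrix e id)ᵀ = (Y * Yᵀ).submatrix e e := by
    rw [Matrix.transpose_submatrix]
    exact Matrix.submatrix_mul_equiv Y Yᵀ e (Equiv.refl τ) e
  rw [hX', Matrix.transpose_mul, Matrix.mul_assoc, ← Matrix.mul_assoc (Y.submatrix e id), hYY,
    Matrix.det_mul, Matrix.det_mul, Matrix.det_submatrix_equiv_self, Matrix.det_transpose]
  linear_combination (Y * Yᵀ).det * hdet

theorem dpl_ext {d k : ℕ}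
    (b : Fin d → Fin d → ℝ) (hb : LinearIndependent ℝ b)
    (a : Fin k → Fin d → ℝ) (ha : LinearIndependent ℝ a)
    (hsub : zspan a ⊆ zspan b)
    (hprim : (Submodule.span ℝ (Set.range a) : Set (Fin d → ℝ)) ∩ zspan b = zspan a) :
    ∃ (n : ℕ) (P : Module.Basis (Fin k ⊕ Fin n) ℤ (Fin d → ℤ)),
      ∀ i, a i = ∑ j, (P (Sum.inl i) j : ℝ) • b j := by
  classical
  have hmem : ∀ i, a i ∈ zspan b := fun i => hsub ⟨Pi.single i 1, by
    simp [Pi.single_apply]⟩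
  choose A hA using hmem
  have hbinj : ∀ x y : Fin d → ℤ, ∑ j, (x j : ℝ) • b j = ∑ j, (y j : ℝ) • b j → x = y := by
    intro x y h
    have h1 : ∑ j, ((x j : ℝ) - (y j : ℝ)) • b j = 0 := by
      simp only [sub_smul, Finset.sum_sub_distrib, h, sub_self]
    have h2 := Fintype.linearIndependent_iff.mp hb _ h1
    funext j
    have := h2 j
    exact_mod_cast sub_eq_zero.mp this
  have hT : ∀ q : Fin k → ℤ, ∑ j, ((∑ i, q i • A i) j : ℝ) • b j = ∑ i, (q i : ℝ) • a i := by
    intro q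
    simp only [hA, Finset.sum_apply, Pi.smul_apply, smul_eq_mul, Int.cast_sum, Int.cast_mul,
      Finset.sum_smul, Finset.smul_sum, smul_smul]
    rw [Finset.sum_comm]
  have hAli : LinearIndependent ℤ A := by
    rw [Fintype.linearIndependent_iff]
    intro q hq i
    have h1 := hT q
    rw [hq] at h1
    simp only [Pi.zero_apply, Int.cast_zero, zero_smul, Finset.sum_const_zero] at h1
    have := Fintype.linearIndependent_iff.mp ha _ h1.symm i
    exact_mod_cast this
  let N : Submodule ℤ (Fin d → ℤ) := Submodule.span ℤ (Set.range A)
  have hN : ∀ x, x ∈ N ↔ ∑ j, (x j : ℝ) • b j ∈ Submodule.span ℝ (Set.range a) := by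
    intro x
    constructor
    · intro hx
      obtain ⟨q, rfl⟩ := (Submodule.mem_span_range_iff_exists_fun ℤ).mp hx
      rw [hT]
      exact Submodule.sum_mem _ fun i _ =>
        Submodule.smul_mem _ _ (Submodule.subset_span ⟨i, rfl⟩)
    · intro hx
      have : ∑ j, (x j : ℝ) • b j ∈ zspan a := by
        rw [← hprim]
        exact ⟨hx, x, rfl⟩
      obtain ⟨q, hq⟩ := this
      rw [← hT q] at hq
      rw [hbinj _ _ hq]
      exact (Submodule.mem_span_range_iff_exists_fun ℤ).mpr ⟨q, rfl⟩
  have htf : Module.IsTorsionFree ℤ ((Fin d → ℤ) ⧸ N) := by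
    apply Module.IsTorsionFree.of_smul_eq_zero
    intro r m hrm
    obtain ⟨x, rfl⟩ := Submodule.Quotient.mk_surjective N m
    by_cases hr : r = 0
    · exact Or.inl hr
    · right
      rw [← Submodule.Quotient.mk_smul, Submodule.Quotient.mk_eq_zero, hN] at hrm
      rw [Submodule.Quotient.mk_eq_zero, hN]
      have h1 : ∑ j, ((r • x) j : ℝ) • b j = (r : ℝ) • ∑ j, (x j : ℝ) • b j := by
        simp [Finset.smul_sum, smul_smul]
      rw [h1] at hrm
      exact (Submodule.smul_mem_iff _ (by exact_mod_cast hr)).mp hrm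
  let bQ := Module.finBasis ℤ ((Fin d → ℤ) ⧸ N)
  let bW : Module.Basis (Fin k) ℤ N := Module.Basis.span hAli
  refine ⟨_, Module.Basis.sumQuot bW bQ, fun i => ?_⟩
  have : (Module.Basis.sumQuot bW bQ) (Sum.inl i) = A i := by
    rw [Module.Basis.sumQuot_inl]
    exact congrArg Subtype.val (Module.Basis.span_apply hAli i)
  rw [this]
  exact hA i

/-- Let `Λ ⊆ ℝ^d` be a `d`-dimensional lattice (with ℤ-basis `b`) and `L ⊆ Λ` a primitive
sublattice (with ℤ-basis `a`). If `c` is a ℤ-basis of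
`L^⊥ = {v ∈ Λ* : ⟨v,x⟩ = 0 for all x ∈ L}`, then `det(L^⊥) = det(L)/det(Λ)`. -/
theorem det_perp_lattice (d k m : ℕ)
    (b : Fin d → Fin d → ℝ) (hb : LinearIndependent ℝ b)
    (a : Fin k → Fin d → ℝ) (ha : LinearIndependent ℝ a)
    (hsub : zspan a ⊆ zspan b)
    (hprim : (Submodule.span ℝ (Set.range a) : Set (Fin d → ℝ)) ∩ zspan b = zspan a)
    (c : Fin m → Fin d → ℝ) (hc : LinearIndependent ℝ c)
    (hcbasis : zspan c =
      {v ∈ dualLat (zspan b) | ∀ x ∈ zspan a, ∑ t, v t * x t = 0}) :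
    latDet c = latDet a / latDet b := by
  classical
  obtain ⟨n, P, hP⟩ := dpl_ext b hb a ha hsub hprim
  -- transition matrices
  let p : Matrix (Fin k ⊕ Fin n) (Fin d) ℤ := Matrix.of fun i j => P i j
  let q : Matrix (Fin d) (Fin k ⊕ Fin n) ℤ := Matrix.of fun j i => P.repr (Pi.single j 1) i
  let B : Matrix (Fin d) (Fin d) ℝ := Matrix.of b
  let E : Matrix (Fin k ⊕ Fin n) (Fin d) ℝ := p.map (Int.cast : ℤ → ℝ) * B
  have hqp : q * p = 1 := by
    ext j t
    have h := congrFun (P.sum_repr (Pi.single j 1)) t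
    simp only [Finset.sum_apply, Pi.smul_apply, smul_eq_mul] at h
    simp only [Matrix.mul_apply, p, q, Matrix.of_apply, h, Matrix.one_apply, Pi.single_apply,
      eq_comm]
  let σ : Fin d ≃ Fin k ⊕ Fin n := (Pi.basisFun ℤ (Fin d)).indexEquiv P
  have hpq : p * q = 1 := (Matrix.mul_eq_one_comm_of_equiv σ).mp hqp
  have hcast : ∀ {α β γ : Type} [Fintype β] (M : Matrix α β ℤ) (M' : Matrix β γ ℤ),
      (M * M').map (Int.cast : ℤ → ℝ) = M.map (Int.cast : ℤ → ℝ) * M'.map (Int.cast : ℤ → ℝ) :=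
    fun M M' => Matrix.map_mul (f := Int.castRingHom ℝ)
  have hqp' : q.map (Int.cast : ℤ → ℝ) * p.map (Int.cast : ℤ → ℝ) = 1 := by
    rw [← hcast, hqp]; simp
  have hpq' : p.map (Int.cast : ℤ → ℝ) * q.map (Int.cast : ℤ → ℝ) = 1 := by
    rw [← hcast, hpq]; simp
  have hBE : B = q.map (Int.cast : ℤ → ℝ) * E := by
    simp only [E]
    rw [← Matrix.mul_assoc, hqp', Matrix.one_mul]
  have hBu : IsUnit B := Matrix.linearIndependent_rows_iff_isUnit.mp hb
  have hBd : IsUnit B.det := (Matrix.isUnit_iff_isUnit_det B).mp hBu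
  have rinj : ∀ {α : Type} [Fintype α] [DecidableEq α] (X : Matrix α (Fin d) ℝ)
      (R : Matrix (Fin d) α ℝ), X * R = 1 → Function.Injective X.vecMul := by
    intro α _ _ X R h x y hxy
    have h2 := congrArg (fun z => Matrix.vecMul z R) hxy
    simpa [Matrix.vecMul_vecMul, h] using h2
  have hEr : E * (B⁻¹ * q.map (Int.cast : ℤ → ℝ)) = 1 := by
    simp only [E]
    rw [Matrix.mul_assoc, ← Matrix.mul_assoc B, Matrix.mul_nonsing_inv _ hBd, Matrix.one_mul,
      hpq']
  have hdetE : (E * E.transpose).det = (B * B.transpose).det :=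
    dpl_gram E B p q (rinj _ _ hEr) (rinj _ _ (Matrix.mul_nonsing_inv _ hBd)) rfl hBE
  have hBpos : 0 < (B * B.transpose).det := by
    rw [Matrix.det_mul, Matrix.det_transpose]
    exact mul_self_pos.mpr hBd.ne_zero
  let G := E * E.transpose
  have hGu : IsUnit G.det := by
    simp only [G, hdetE]
    exact hBpos.ne'.isUnit
  have hGt : G.transpose = G := by simp [G, Matrix.transpose_mul]
  let F := G⁻¹ * E
  have hFE : F * E.transpose = 1 := by
    simp only [F]
    rw [Matrix.mul_assoc]
    exact Matrix.nonsing_inv_mul _ hGu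
  have hEF : E.transpose * F = 1 := (Matrix.mul_eq_one_comm_of_equiv σ.symm).mp hFE
  have hFF : F * F.transpose = G⁻¹ := by
    have : F.transpose = E.transpose * G⁻¹ := by
      simp only [F]
      rw [Matrix.transpose_mul, Matrix.transpose_nonsing_inv, hGt]
    rw [this, ← Matrix.mul_assoc, hFE, Matrix.one_mul]
  have hjac := dpl_jacobi G G⁻¹ (Matrix.mul_nonsing_inv _ hGu)
  -- rows of E
  have hErow : ∀ i, E i = ∑ j, (p i j : ℝ) • b j := by
    intro i
    funext t
    simp [E, B, Matrix.mul_apply]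
  have hEzb : ∀ i, E i ∈ zspan b := fun i => ⟨p i, hErow i⟩
  have hEa : ∀ i, E (Sum.inl i) = a i := fun i => by rw [hErow, hP i]; rfl
  have haz : ∀ i, a i ∈ zspan a := fun i => ⟨Pi.single i 1, by
    simp [Pi.single_apply]⟩
  have hcz : ∀ i, c i ∈ zspan c := fun i => ⟨Pi.single i 1, by
    simp [Pi.single_apply]⟩
  let F2 : Matrix (Fin n) (Fin d) ℝ := Matrix.of fun i => F (Sum.inr i)
  -- rows of F2 lie in the lattice
  have hEFd : ∀ i j, ∑ t, F i t * E j t = if i = j then 1 else 0 := by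
    intro i j
    have := congrFun (congrFun hFE i) j
    simpa [Matrix.mul_apply, Matrix.one_apply] using this
  have hF2mem : ∀ i, F2 i ∈ zspan c := by
    intro i
    rw [hcbasis]
    refine ⟨?_, ?_⟩
    · rintro x ⟨z, rfl⟩
      refine ⟨∑ j, z j * q j (Sum.inr i), ?_⟩
      have hb' : ∀ j, ∑ t, b j t * F2 i t = (q j (Sum.inr i) : ℝ) := by
        intro j
        have h1 : B * F.transpose = q.map (Int.cast : ℤ → ℝ) := by
          have h2 : E * F.transpose = 1 := by
            rw [← Matrix.transpose_transpose E, ← Matrix.transpose_mul, hFE,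
              Matrix.transpose_one]
          rw [hBE, Matrix.mul_assoc, h2, Matrix.mul_one]
        have := congrFun (congrFun h1 j) (Sum.inr i)
        simpa [Matrix.mul_apply, B, F2] using this
      push_cast
      simp only [← hb', Finset.sum_apply, Pi.smul_apply, smul_eq_mul, Finset.sum_mul,
        Finset.mul_sum]
      rw [Finset.sum_comm]
      simp only [mul_assoc]
    · rintro x ⟨z, rfl⟩
      have h0 : ∀ j, ∑ t, F2 i t * a j t = 0 := by
        intro j
        have := hEFd (Sum.inr i) (Sum.inl j)
        rw [hEa] at this
        simpa [F2] using this
      simp only [Finset.sum_apply, Pi.smul_apply, smul_eq_mul, Finset.mul_sum]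
      rw [Finset.sum_comm]
      refine Finset.sum_eq_zero fun j _ => ?_
      have h1 : ∑ t, F2 i t * ((z j : ℝ) * a j t) = (z j : ℝ) * ∑ t, F2 i t * a j t := by
        rw [Finset.mul_sum]
        exact Finset.sum_congr rfl fun t _ => by ring
      rw [h1, h0, mul_zero]
  have hcmem : ∀ i, ∃ u : Fin n → ℤ, c i = ∑ j, (u j : ℝ) • F2 j := by
    intro i
    have hi := hcz i
    rw [hcbasis] at hi
    obtain ⟨h1, h2⟩ := hi
    choose u hu using fun j : Fin n => h1 (E (Sum.inr j)) (hEzb _)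
    refine ⟨u, ?_⟩
    have h3 : c i = Matrix.vecMul (Matrix.vecMul (c i) E.transpose) F := by
      rw [Matrix.vecMul_vecMul, hEF, Matrix.vecMul_one]
    funext t
    have h4 := congrFun h3 t
    rw [h4]
    simp only [Matrix.vecMul, dotProduct, Fintype.sum_sum_type, Matrix.transpose_apply]
    have h5 : ∀ j, ∑ s, c i s * E (Sum.inl j) s = 0 := by
      intro j
      rw [hEa]
      exact h2 _ (haz j)
    have h6 : ∀ j, ∑ s, c i s * E (Sum.inr j) s = u j := by
      intro j
      rw [← hu j]
      exact Finset.sum_congr rfl fun s _ => mul_comm _ _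
    simp [h5, h6, F2]
  choose U hU using hcmem
  choose V hV using hF2mem
  let C : Matrix (Fin m) (Fin d) ℝ := Matrix.of c
  have hgc : (C * C.transpose).det = (F2 * F2.transpose).det := by
    refine dpl_gram C F2 (Matrix.of U) (Matrix.of V) ?_ ?_ ?_ ?_
    · exact Matrix.vecMul_injective_iff.mpr hc
    · refine rinj F2 (Matrix.of fun t j => E (Sum.inr j) t) ?_
      ext i j
      have := hEFd (Sum.inr i) (Sum.inr j)
      simpa [Matrix.mul_apply, Matrix.one_apply, F2] using this
    · ext i t
      have := congrFun (hU i) t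
      simpa [C, Matrix.mul_apply] using this
    · ext i t
      have := congrFun (hV i) t
      simpa [C, Matrix.mul_apply] using this
  have hF22 : F2 * F2.transpose = (G⁻¹).toBlocks₂₂ := by
    rw [← hFF]
    ext i j
    simp [Matrix.mul_apply, F2, Matrix.toBlocks₂₂]
  have hlc : latDet c = Real.sqrt (C * C.transpose).det := rfl
  have hlb : latDet b = Real.sqrt (B * B.transpose).det := rfl
  have hla : latDet a = Real.sqrt G.toBlocks₁₁.det := by
    unfold latDet
    congr 2
    ext i j
    simp [Matrix.toBlocks₁₁, G, Matrix.mul_apply, hEa]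
  have hGB : G.det = (B * B.transpose).det := hdetE
  rw [hlc, hlb, hla, hgc, hF22, ← hjac, ← hGB, mul_comm, ← Real.sqrt_div' _ (hGB ▸ hBpos.le),
    mul_div_assoc, div_self hGu.ne_zero, mul_one]
end

section
/- Let P ⊆ ℝ^d be a full-dimensional polytope, x ∈ ℝ^d, and define the solid angle ω_P(x) := lim_{ε→0⁺} vol(B(x,ε) ∩ P)/vol(B(x,ε)). Then ω_P(x) = lim_{ε→0⁺} (1_P ∗ φ_{d,ε})(x), where φ_{d,ε}(x) := ε^{-d/2} e^{-π‖x‖²/ε} is the heat Gaussian and ∗ denotes convolution. -/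
open scoped BigOperators
open MeasureTheory
attribute [local instance] Classical.propDecidable

/-- The Euclidean ball of radius `ε` around `c` in `ℝ^d`. -/
def eball {d : ℕ} (c : Fin d → ℝ) (ε : ℝ) : Set (Fin d → ℝ) :=
  {y | ∑ i, (y i - c i) ^ 2 < ε ^ 2}

/-- `saTendsto Q c ω` says that the solid angle of `Q` at `c` exists and equals `ω`:
the proportion of a small Euclidean ball around `c` occupied by `Q` tends to `ω`. -/
def saTendsto {d : ℕ} (Q : Set (Fin d → ℝ)) (c : Fin d → ℝ) (ω : ℝ) : Prop :=
  Filter.Tendsto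
    (fun ε : ℝ => (volume (eball c ε ∩ Q)).toReal / (volume (eball c ε)).toReal)
    (nhdsWithin 0 (Set.Ioi 0)) (nhds ω)

/-- The heat Gaussian `φ_{d,ε}(x) = ε^{-d/2} e^{-π‖x‖²/ε}`. -/
noncomputable def gaussKer (d : ℕ) (ε : ℝ) (x : Fin d → ℝ) : ℝ :=
  ε ^ (-(d : ℝ) / 2) * Real.exp (-Real.pi * (∑ i, (x i) ^ 2) / ε)

open scoped Pointwise

lemma eball_eq_smul {d : ℕ} (c : Fin d → ℝ) {r : ℝ} (hr : 0 < r) :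
    eball c r = Set.image (fun y => c + y) (r • eball (0 : Fin d → ℝ) 1) := by
  ext y
  simp only [Set.image_add_left, Set.mem_preimage, Set.mem_smul_set_iff_inv_smul_mem₀ hr.ne']
  simp only [eball, Set.mem_ofPred_eq, Pi.smul_apply, Pi.add_apply, Pi.neg_apply, smul_eq_mul,
    Pi.zero_apply, sub_zero, mul_pow, ← Finset.mul_sum, one_pow]
  rw [inv_pow, inv_mul_lt_iff₀ (by positivity), mul_one]
  simp only [neg_add_eq_sub]

lemma volume_eball {d : ℕ} (c : Fin d → ℝ) {r : ℝ} (hr : 0 < r) :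
    volume (eball c r) = ENNReal.ofReal (r ^ d) * volume (eball (0 : Fin d → ℝ) 1) := by
  rw [eball_eq_smul c hr, Set.image_add_left, measure_preimage_add, Measure.addHaar_smul]
  simp [abs_of_pos hr]

lemma isOpen_eball {d : ℕ} (c : Fin d → ℝ) (r : ℝ) : IsOpen (eball c r) :=
  isOpen_lt (by fun_prop) continuous_const

lemma eball_one_lt_top {d : ℕ} : volume (eball (0 : Fin d → ℝ) 1) < ⊤ := by
  refine lt_of_le_of_lt (measure_mono (t := Metric.closedBall 0 1) ?_)
    (isCompact_closedBall _ _).measure_lt_top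
  intro y hy
  simp only [eball, Set.mem_ofPred_eq, Pi.zero_apply, sub_zero, one_pow] at hy
  rw [mem_closedBall_zero_iff, pi_norm_le_iff_of_nonneg zero_le_one]
  intro i
  have : y i ^ 2 ≤ ∑ i, y i ^ 2 :=
    Finset.single_le_sum (f := fun i => y i ^ 2) (fun i _ => sq_nonneg _) (Finset.mem_univ i)
  rw [Real.norm_eq_abs]
  exact (abs_le_one_iff_mul_self_le_one).2 (by nlinarith)

lemma eball_one_pos {d : ℕ} : 0 < volume (eball (0 : Fin d → ℝ) 1) :=
  (isOpen_eball _ _).measure_pos _ ⟨0, by simp [eball]⟩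

lemma eball_lt_top {d : ℕ} (c : Fin d → ℝ) {r : ℝ} (hr : 0 < r) : volume (eball c r) < ⊤ := by
  rw [volume_eball c hr]
  exact ENNReal.mul_lt_top ENNReal.ofReal_lt_top eball_one_lt_top

lemma exp_layer {a : ℝ} (ha : 0 ≤ a) :
    ENNReal.ofReal (Real.exp (-Real.pi * a)) =
      ∫⁻ u in Set.Ioi (0 : ℝ), (Set.Ioi a).indicator
        (fun u => ENNReal.ofReal (Real.pi * Real.exp (-Real.pi * u))) u := by
  rw [lintegral_indicator measurableSet_Ioi, Measure.restrict_restrict measurableSet_Ioi,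
    Set.inter_eq_left.2 (Set.Ioi_subset_Ioi ha), ← ofReal_integral_eq_lintegral_ofReal]
  · rw [integral_const_mul, integral_exp_mul_Ioi (by simp [Real.pi_pos])]
    congr 1
    field_simp
  · exact (integrableOn_exp_mul_Ioi (by simp [Real.pi_pos]) _).const_mul _
  · exact Filter.Eventually.of_forall fun u => by positivity

lemma meas_aux {d : ℕ} (Q : Set (Fin d → ℝ)) (x : Fin d → ℝ) {ε : ℝ} (hε : 0 < ε) :
    Measurable (fun u : ℝ => volume (eball x (√(ε * u)) ∩ Q)) := by
  refine Monotone.measurable fun u v huv => measure_mono ?_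
  refine Set.inter_subset_inter_left _ fun y hy => ?_
  simp only [eball, Set.mem_ofPred_eq] at hy ⊢
  refine lt_of_lt_of_le hy ?_
  gcongr

lemma gauss_layer {d : ℕ} {Q : Set (Fin d → ℝ)} (hQ : MeasurableSet Q) (x : Fin d → ℝ)
    {ε : ℝ} (hε : 0 < ε) :
    ∫ y : Fin d → ℝ, Set.indicator Q (fun _ => (1 : ℝ)) y * gaussKer d ε (x - y) =
      ∫ u in Set.Ioi (0 : ℝ), Real.pi * Real.exp (-Real.pi * u) *
        (ε ^ (-(d : ℝ) / 2) * (volume (eball x (√(ε * u)) ∩ Q)).toReal) := by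
  rw [integral_eq_lintegral_of_nonneg_ae, integral_eq_lintegral_of_nonneg_ae]
  rotate_left
  · exact Filter.Eventually.of_forall fun u => by positivity
  · have := (meas_aux Q x hε).ennreal_toReal
    exact Measurable.aestronglyMeasurable (by fun_prop)
  · refine Filter.Eventually.of_forall fun y => mul_nonneg ?_ ?_
    · exact Set.indicator_nonneg (fun _ _ => zero_le_one) _
    · unfold gaussKer; positivity
  · refine Measurable.aestronglyMeasurable ((measurable_const.indicator hQ).mul ?_)
    unfold gaussKer
    fun_prop
  congr 1
  set K := ENNReal.ofReal (ε ^ (-(d : ℝ) / 2)) with hK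
  let S : Set ((Fin d → ℝ) × ℝ) := {p | ∑ i, (p.1 i - x i) ^ 2 < ε * p.2}
  have hS : MeasurableSet S := measurableSet_lt (by fun_prop) (by fun_prop)
  let G : (Fin d → ℝ) → ℝ → ENNReal := fun y u =>
    (S ∩ (Q ×ˢ Set.univ)).indicator
      (fun p => K * ENNReal.ofReal (Real.pi * Real.exp (-Real.pi * p.2))) (y, u)
  have hG : Measurable (Function.uncurry G) := by
    refine Measurable.indicator (by fun_prop) (hS.inter (hQ.prod MeasurableSet.univ))
  trans ∫⁻ y : Fin d → ℝ, ∫⁻ u in Set.Ioi (0 : ℝ), G y u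
  · refine lintegral_congr fun y => ?_
    by_cases hy : y ∈ Q
    · rw [Set.indicator_of_mem hy, one_mul, gaussKer, ENNReal.ofReal_mul (by positivity)]
      have e : -Real.pi * (∑ i, ((x - y) i) ^ 2) / ε
          = -Real.pi * ((∑ i, (y i - x i) ^ 2) / ε) := by
        rw [mul_div_assoc]
        congr 3
        ext i
        simp only [Pi.sub_apply]; ring
      rw [e, exp_layer (by positivity), ← lintegral_const_mul' _ _ ENNReal.ofReal_ne_top]
      refine lintegral_congr fun u => ?_
      simp only [G, Set.indicator_apply, S, Set.mem_inter_iff, Set.mem_ofPred_eq, Set.mem_prod, hy,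
        Set.mem_univ, and_true, Set.mem_Ioi, div_lt_iff₀' hε]
      split_ifs <;> simp [hK]
    · simp [G, hy]
  · rw [lintegral_lintegral_swap hG.aemeasurable]
    refine setLIntegral_congr_fun measurableSet_Ioi fun u hu => ?_
    have hu : 0 < u := hu
    have hpos : 0 < ε * u := mul_pos hε hu
    have hfin : volume (eball x (√(ε * u)) ∩ Q) ≠ ⊤ :=
      (lt_of_le_of_lt (measure_mono Set.inter_subset_left)
        (eball_lt_top x (Real.sqrt_pos.2 hpos))).ne
    have e : ∀ y, G y u = (eball x (√(ε * u)) ∩ Q).indicator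
        (fun _ => K * ENNReal.ofReal (Real.pi * Real.exp (-Real.pi * u))) y := by
      intro y
      simp only [G, Set.indicator_apply, S, Set.mem_inter_iff, Set.mem_ofPred_eq, Set.mem_prod,
        Set.mem_univ, and_true, eball, Real.sq_sqrt hpos.le]
    simp only [e]
    rw [lintegral_indicator ((isOpen_eball _ _).measurableSet.inter hQ), setLIntegral_const,
      ENNReal.ofReal_mul (p := Real.pi * Real.exp (-Real.pi * u)) (by positivity),
      ENNReal.ofReal_mul (p := ε ^ (-(d : ℝ) / 2))
      (by positivity), ENNReal.ofReal_toReal hfin]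
    ring

lemma gauss_total (d : ℕ) : ∫ y : Fin d → ℝ, gaussKer d 1 (0 - y) = 1 := by
  have : ∀ y : Fin d → ℝ, gaussKer d 1 (0 - y) = ∏ i, Real.exp (-Real.pi * (y i) ^ 2) := by
    intro y
    simp [gaussKer, ← Real.exp_sum, Finset.mul_sum]
  simp only [this]
  rw [integral_fintype_prod_volume_eq_prod (fun _ : Fin d => fun t : ℝ => Real.exp (-Real.pi * t ^ 2))]
  simp only [integral_gaussian]
  simp [Real.pi_ne_zero]

lemma scale_aux (d : ℕ) (x : Fin d → ℝ) {ε u : ℝ} (hε : 0 < ε) (hu : 0 < u) :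
    ε ^ (-(d : ℝ) / 2) * (volume (eball x (√(ε * u)))).toReal =
      √u ^ d * (volume (eball (0 : Fin d → ℝ) 1)).toReal := by
  rw [volume_eball x (Real.sqrt_pos.2 (mul_pos hε hu)), ENNReal.toReal_mul,
    ENNReal.toReal_ofReal (by positivity), Real.sqrt_mul hε.le, mul_pow]
  have : ε ^ (-(d : ℝ) / 2) * √ε ^ d = 1 := by
    rw [Real.sqrt_eq_rpow, ← Real.rpow_natCast, ← Real.rpow_mul hε.le, ← Real.rpow_add hε]
    ring_nf
    simp
  linear_combination (√u ^ d * (volume (eball (0 : Fin d → ℝ) 1)).toReal) * this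

lemma weight_total (d : ℕ) :
    ∫ u in Set.Ioi (0 : ℝ), Real.pi * Real.exp (-Real.pi * u) *
      (√u ^ d * (volume (eball (0 : Fin d → ℝ) 1)).toReal) = 1 := by
  have h := gauss_layer (d := d) MeasurableSet.univ 0 one_pos
  simp only [Set.indicator_univ, one_mul, Set.inter_univ] at h
  refine Eq.trans ?_ (h.symm.trans (gauss_total d))
  refine setIntegral_congr_fun measurableSet_Ioi fun u hu => ?_
  have := scale_aux d 0 one_pos hu
  simp only [one_mul] at this
  simp only [this]

/-- The solid angle of a full-dimensional polytope `P` at `x` equals the limit as `ε → 0⁺`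
of the convolution `(1_P ∗ φ_{d,ε})(x)` with the heat Gaussian. -/
theorem solid_angle_eq_gaussian_convolution_limit (d : ℕ) (V : Finset (Fin d → ℝ))
    (P : Set (Fin d → ℝ)) (hP : P = convexHull ℝ (V : Set (Fin d → ℝ)))
    (hfull : (interior P).Nonempty) (x : Fin d → ℝ) (ω : ℝ)
    (hω : saTendsto P x ω) :
    Filter.Tendsto
      (fun ε : ℝ => ∫ y : Fin d → ℝ, Set.indicator P (fun _ => (1 : ℝ)) y * gaussKer d ε (x - y))
      (nhdsWithin 0 (Set.Ioi 0)) (nhds ω) := by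
  have hPm : MeasurableSet P := by
    rw [hP]
    exact (V.finite_toSet.isCompact_convexHull (𝕜 := ℝ)).isClosed.measurableSet
  have hev : ∀ᶠ ε : ℝ in nhdsWithin 0 (Set.Ioi 0), 0 < ε := self_mem_nhdsWithin
  set W : ℝ → ℝ := fun u => Real.pi * Real.exp (-Real.pi * u) *
      (√u ^ d * (volume (eball (0 : Fin d → ℝ) 1)).toReal) with hW
  have hWtot : ∫ u in Set.Ioi (0 : ℝ), W u = 1 := weight_total d
  have hWint : Integrable W (volume.restrict (Set.Ioi 0)) := by
    by_contra h
    rw [integral_undef h] at hWtot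
    exact zero_ne_one hWtot
  have hlim : ω = ∫ u in Set.Ioi (0 : ℝ), W u * ω := by
    rw [integral_mul_const, hWtot, one_mul]
  rw [hlim]
  have hcongr : (fun ε : ℝ => ∫ u in Set.Ioi (0 : ℝ), Real.pi * Real.exp (-Real.pi * u) *
        (ε ^ (-(d : ℝ) / 2) * (volume (eball x (√(ε * u)) ∩ P)).toReal))
      =ᶠ[nhdsWithin 0 (Set.Ioi 0)] (fun ε : ℝ => ∫ y : Fin d → ℝ,
        Set.indicator P (fun _ => (1 : ℝ)) y * gaussKer d ε (x - y)) := by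
    filter_upwards [hev] with ε hε using (gauss_layer hPm x hε).symm
  refine Filter.Tendsto.congr' hcongr ?_
  refine tendsto_integral_filter_of_dominated_convergence W ?_ ?_ hWint ?_
  · filter_upwards [hev] with ε hε
    have := (meas_aux P x hε).ennreal_toReal
    exact Measurable.aestronglyMeasurable (by fun_prop)
  · filter_upwards [hev] with ε hε
    refine (ae_restrict_iff' measurableSet_Ioi).2 (Filter.Eventually.of_forall fun u hu => ?_)
    have hu : 0 < u := hu
    rw [Real.norm_of_nonneg (by positivity), hW]
    simp only
    rw [← scale_aux d x hε hu]
    gcongr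
    · exact (eball_lt_top x (Real.sqrt_pos.2 (mul_pos hε hu))).ne
    · exact Set.inter_subset_left
  · refine (ae_restrict_iff' measurableSet_Ioi).2 (Filter.Eventually.of_forall fun u hu => ?_)
    have hu : 0 < u := hu
    have ht : Filter.Tendsto (fun ε : ℝ => √(ε * u)) (nhdsWithin 0 (Set.Ioi 0))
        (nhdsWithin 0 (Set.Ioi 0)) := by
      refine tendsto_nhdsWithin_iff.2 ⟨?_, ?_⟩
      · have : Continuous (fun ε : ℝ => √(ε * u)) := by fun_prop
        have h0 := this.tendsto 0
        simp only [zero_mul, Real.sqrt_zero] at h0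
        exact h0.mono_left nhdsWithin_le_nhds
      · filter_upwards [hev] with ε hε using Real.sqrt_pos.2 (mul_pos hε hu)
    have h2 := (Filter.Tendsto.comp hω ht).const_mul (W u)
    refine h2.congr' ?_
    filter_upwards [hev] with ε hε
    have hr := Real.sqrt_pos.2 (mul_pos hε hu)
    have hv : (volume (eball x (√(ε * u)))).toReal ≠ 0 := by
      refine (ENNReal.toReal_pos ?_ (eball_lt_top x hr).ne).ne'
      rw [volume_eball x hr]
      exact mul_ne_zero (ENNReal.ofReal_pos.2 (pow_pos hr d)).ne' eball_one_pos.ne'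
    simp only [hW, Function.comp_apply]
    rw [← scale_aux d x hε hu, mul_assoc, mul_assoc (ε ^ _), mul_div_cancel₀ _ hv]
end

section
/- Let W ∈ ℤ^{d×d} be invertible with columns w₁,…,w_d, let e = (e₁,…,e_d) be positive integers, and x ∈ ℝ^d. Then lim_{ε→0⁺} (2πi)^{-|e|} Σ_{ξ∈ℤ^d, ⟨w_j,ξ⟩≠0 ∀j} e^{-2πi⟨x,ξ⟩} e^{-πε‖ξ‖²} / Π_j ⟨w_j,ξ⟩^{e_j} = ((-1)^d / (e₁!⋯e_d! |det W|)) Σ_{n ∈ ℤ^d ∩ P_{W,x}} 𝓑_e(W^{-1}(n-x)) ω_{P_{W,x}}(n), where P_{W,x} := x + W[0,1]^d. -/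
open scoped BigOperators
open MeasureTheory Matrix
attribute [local instance] Classical.propDecidable

/-- The multivariate truncated Bernoulli polynomial factor `B_r` supported on `[0,1]`. -/
noncomputable def bernTrunc (r : ℕ) (x : ℝ) : ℝ :=
  if x ∈ Set.Icc (0 : ℝ) 1 then Polynomial.aeval x (Polynomial.bernoulli r) else 0

/-- The standard Gaussian `exp (-π |z|²)`. -/
noncomputable def gau {d : ℕ} (z : Fin d → ℝ) : ℝ := Real.exp (-Real.pi * ∑ i, z i ^ 2)

lemma gau_eq_prod {d : ℕ} (z : Fin d → ℝ) : gau z = ∏ i, Real.exp (-Real.pi * z i ^ 2) := by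
  rw [gau, Finset.mul_sum, Real.exp_sum]

lemma gau_pos {d : ℕ} (z : Fin d → ℝ) : 0 < gau z := Real.exp_pos _

lemma gau_continuous {d : ℕ} : Continuous (gau (d := d)) := by
  unfold gau; fun_prop

lemma gau_integral {d : ℕ} : ∫ z : Fin d → ℝ, gau z = 1 := by
  simp_rw [gau_eq_prod]
  rw [integral_fintype_prod_volume_eq_prod (f := fun _ (t : ℝ) => Real.exp (-Real.pi * t ^ 2))]
  rw [integral_gaussian]
  simp

lemma gau_integrable {d : ℕ} : Integrable (gau (d := d)) := by
  by_contra h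
  have := integral_undef h
  rw [gau_integral] at this
  exact one_ne_zero this

lemma eball_subset {d : ℕ} (r : ℝ) (hr : 0 < r) : eball (0 : Fin d → ℝ) r ⊆ Metric.closedBall 0 r := by
  intro y hy
  simp only [eball, Set.mem_ofPred_eq, Pi.zero_apply, sub_zero] at hy
  rw [mem_closedBall_zero_iff, pi_norm_le_iff_of_nonneg hr.le]
  intro i
  have h1 : y i ^ 2 ≤ ∑ i, y i ^ 2 := Finset.single_le_sum (f := fun i => y i ^ 2) (fun i _ => sq_nonneg _) (Finset.mem_univ i)
  rw [Real.norm_eq_abs]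
  exact abs_le_of_sq_le_sq (by linarith) hr.le

lemma eball_finite {d : ℕ} (r : ℝ) (hr : 0 < r) : volume (eball (0 : Fin d → ℝ) r) < ⊤ :=
  (measure_mono (eball_subset r hr)).trans_lt measure_closedBall_lt_top

lemma eball_pos {d : ℕ} (r : ℝ) (hr : 0 < r) : 0 < volume (eball (0 : Fin d → ℝ) r) := by
  apply IsOpen.measure_pos
  · unfold eball
    exact isOpen_lt (by fun_prop) (by fun_prop)
  · exact ⟨0, by simp [eball]; positivity⟩

lemma eball_scale {d : ℕ} (Q : Set (Fin d → ℝ)) (c : Fin d → ℝ) (s r : ℝ) (hs : 0 < s) :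
    volume (eball 0 r ∩ {z | c + s • z ∈ Q}) = ENNReal.ofReal |(s ^ d)⁻¹| * volume (eball c (s * r) ∩ Q) := by
  have h1 : eball 0 r ∩ {z | c + s • z ∈ Q} = (s • ·) ⁻¹' ((c + ·) ⁻¹' (eball c (s * r) ∩ Q)) := by
    ext z
    simp only [eball, Set.mem_inter_iff, Set.mem_ofPred_eq, Set.mem_preimage, Pi.zero_apply, sub_zero,
      Pi.add_apply, Pi.smul_apply, smul_eq_mul, add_sub_cancel_left, mul_pow, ← Finset.mul_sum]
    rw [mul_lt_mul_iff_right₀ (by positivity)]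
  rw [h1, Measure.addHaar_preimage_smul _ hs.ne', measure_preimage_add]
  simp

lemma sa_scale {d : ℕ} (Q : Set (Fin d → ℝ)) (c : Fin d → ℝ) (ω : ℝ) (h : saTendsto Q c ω)
    (r : ℝ) (hr : 0 < r) :
    Filter.Tendsto (fun s : ℝ => (volume (eball 0 r ∩ {z | c + s • z ∈ Q})).toReal)
      (nhdsWithin 0 (Set.Ioi 0)) (nhds (ω * (volume (eball (0 : Fin d → ℝ) r)).toReal)) := by
  have ht : Filter.Tendsto (fun s : ℝ => s * r) (nhdsWithin 0 (Set.Ioi 0)) (nhdsWithin 0 (Set.Ioi 0)) := by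
    apply tendsto_nhdsWithin_iff.2
    constructor
    · have : Filter.Tendsto (fun s : ℝ => s * r) (nhds 0) (nhds (0 * r)) := by
        apply Continuous.tendsto; fun_prop
      rw [zero_mul] at this
      exact this.mono_left nhdsWithin_le_nhds
    · filter_upwards [self_mem_nhdsWithin] with s hs
      exact mul_pos hs hr
  have h2 := (h.comp ht).mul_const (volume (eball (0 : Fin d → ℝ) r)).toReal
  refine h2.congr' ?_
  filter_upwards [self_mem_nhdsWithin] with s hs
  have hs : 0 < s := hs
  have e1 := eball_scale Q c s r hs
  have e2 := eball_scale Set.univ c s r hs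
  simp only [Set.mem_univ, Set.ofPred_true, Set.inter_univ] at e2
  have hp := eball_pos (d := d) r hr
  have hf := eball_finite (d := d) r hr
  have h3 : 0 < (volume (eball (0 : Fin d → ℝ) r)).toReal := ENNReal.toReal_pos hp.ne' hf.ne
  simp only [Function.comp]
  rw [e1, e2, ENNReal.toReal_mul, ENNReal.toReal_mul]
  rw [e2, ENNReal.toReal_mul] at h3
  have : (volume (eball c (s * r))).toReal ≠ 0 := by
    intro h0; rw [h0, mul_zero] at h3; exact lt_irrefl _ h3
  field_simp

lemma gau_level {d : ℕ} (t : ℝ) (ht : 0 < t) (ht1 : t < 1) :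
    {z : Fin d → ℝ | t < gau z} = eball 0 (Real.sqrt (-Real.log t / Real.pi)) := by
  have hl : Real.log t < 0 := Real.log_neg ht ht1
  ext z
  simp only [eball, Set.mem_ofPred_eq, gau, Pi.zero_apply, sub_zero]
  rw [Real.sq_sqrt (div_nonneg (by linarith) Real.pi_pos.le), lt_div_iff₀ Real.pi_pos,
    ← Real.log_lt_iff_lt_exp ht]
  constructor <;> intro h <;> nlinarith

lemma gau_level' {d : ℕ} (t : ℝ) (ht1 : 1 ≤ t) :
    {z : Fin d → ℝ | t < gau z} = ∅ := by
  ext z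
  simp only [Set.mem_ofPred_eq, Set.mem_empty_iff_false, iff_false, not_lt, gau]
  refine le_trans ?_ ht1
  rw [Real.exp_le_one_iff]
  have : 0 ≤ ∑ i, z i ^ 2 := Finset.sum_nonneg fun i _ => sq_nonneg _
  nlinarith [Real.pi_pos]

lemma gau_level_finite {d : ℕ} (t : ℝ) (ht : 0 < t) : volume {z : Fin d → ℝ | t < gau z} < ⊤ := by
  rcases lt_or_ge t 1 with h | h
  · rw [gau_level t ht h]
    exact eball_finite _ (Real.sqrt_pos.2 (div_pos (by linarith [Real.log_neg ht h]) Real.pi_pos))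
  · rw [gau_level' t h]; simp

lemma gau_lim {d : ℕ} (Q : Set (Fin d → ℝ)) (hQ : MeasurableSet Q) (c : Fin d → ℝ) (ω : ℝ)
    (h : saTendsto Q c ω) :
    Filter.Tendsto (fun s : ℝ => ∫ z in {z | c + s • z ∈ Q}, gau z)
      (nhdsWithin 0 (Set.Ioi 0)) (nhds ω) := by
  have hm : ∀ s : ℝ, MeasurableSet {z : Fin d → ℝ | c + s • z ∈ Q} := fun s =>
    (show Measurable fun z : Fin d → ℝ => c + s • z by fun_prop) hQ
  have h0 : ∫ t in Set.Ioi (0 : ℝ), volume.real {z : Fin d → ℝ | t < gau z} = 1 := by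
    rw [← gau_integrable.integral_eq_integral_meas_lt (Filter.Eventually.of_forall fun z => (gau_pos z).le),
      gau_integral]
  have hi : Integrable (fun t : ℝ => volume.real {z : Fin d → ℝ | t < gau z}) (volume.restrict (Set.Ioi 0)) := by
    by_contra hc
    rw [integral_undef hc] at h0
    exact zero_ne_one h0
  have e : ∀ s : ℝ, ∫ z in {z | c + s • z ∈ Q}, gau z =
      ∫ t in Set.Ioi (0 : ℝ), (volume.restrict {z | c + s • z ∈ Q}).real {z : Fin d → ℝ | t < gau z} := fun s =>
    gau_integrable.restrict.integral_eq_integral_meas_lt (Filter.Eventually.of_forall fun z => (gau_pos z).le)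
  simp_rw [e]
  have hω : ω = ∫ t in Set.Ioi (0 : ℝ), ω * volume.real {z : Fin d → ℝ | t < gau z} := by
    rw [integral_const_mul, h0, mul_one]
  rw [hω]
  have hlm : ∀ t : ℝ, MeasurableSet {z : Fin d → ℝ | t < gau z} := fun t =>
    measurableSet_lt measurable_const gau_continuous.measurable
  apply tendsto_integral_filter_of_dominated_convergence _ _ _ hi
  · filter_upwards [self_mem_ae_restrict measurableSet_Ioi] with t ht
    have ht : 0 < t := ht
    simp only [Measure.real, Measure.restrict_apply (hlm t)]
    rcases lt_or_ge t 1 with h1 | h1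
    · rw [gau_level t ht h1]
      exact sa_scale Q c ω h _ (Real.sqrt_pos.2 (div_pos (by linarith [Real.log_neg ht h1]) Real.pi_pos))
    · rw [gau_level' t h1]; simp
  · refine Filter.Eventually.of_forall fun s => ?_
    apply Measurable.aestronglyMeasurable
    apply Measurable.ennreal_toReal
    apply Antitone.measurable
    intro a b hab
    exact measure_mono fun z hz => lt_of_le_of_lt hab hz
  · refine Filter.Eventually.of_forall fun s => ?_
    filter_upwards [self_mem_ae_restrict measurableSet_Ioi] with t ht
    rw [Real.norm_eq_abs, abs_of_nonneg measureReal_nonneg]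
    simp only [Measure.real, Measure.restrict_apply (hlm t)]
    exact ENNReal.toReal_mono (gau_level_finite t ht).ne (measure_mono Set.inter_subset_left)

lemma gau_lim_fun {d : ℕ} (Q : Set (Fin d → ℝ)) (hQ : MeasurableSet Q) (c : Fin d → ℝ) (ω : ℝ)
    (h : saTendsto Q c ω) (f : (Fin d → ℝ) → ℝ) (hf : Continuous f) (M : ℝ) (hM : ∀ y ∈ Q, |f y| ≤ M) :
    Filter.Tendsto (fun s : ℝ => ∫ z in {z | c + s • z ∈ Q}, f (c + s • z) * gau z)
      (nhdsWithin 0 (Set.Ioi 0)) (nhds (f c * ω)) := by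
  have hm : ∀ s : ℝ, MeasurableSet {z : Fin d → ℝ | c + s • z ∈ Q} := fun s =>
    (show Measurable fun z : Fin d → ℝ => c + s • z by fun_prop) hQ
  have hg : Continuous (gau (d := d)) := gau_continuous
  have hb : ∀ (s : ℝ) z, ‖({z | c + s • z ∈ Q}.indicator (fun z => (f (c + s • z) - f c) * gau z)) z‖ ≤
      (|M| + |f c|) * gau z := by
    intro s z
    by_cases hz : c + s • z ∈ Q
    · rw [Set.indicator_of_mem (by exact hz), norm_mul, Real.norm_eq_abs, Real.norm_eq_abs, abs_of_pos (gau_pos z)]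
      apply mul_le_mul_of_nonneg_right _ (gau_pos z).le
      exact (abs_sub _ _).trans (add_le_add ((hM _ hz).trans (le_abs_self _)) le_rfl)
    · rw [Set.indicator_of_notMem (by exact hz), norm_zero]
      have := gau_pos z
      positivity
  have hmeas : ∀ s : ℝ, AEStronglyMeasurable ({z | c + s • z ∈ Q}.indicator (fun z => (f (c + s • z) - f c) * gau z)) volume := by
    intro s
    apply AEStronglyMeasurable.indicator _ (hm s)
    apply Continuous.aestronglyMeasurable
    fun_prop
  have h1 : Filter.Tendsto (fun s : ℝ => ∫ z, ({z | c + s • z ∈ Q}.indicator (fun z => (f (c + s • z) - f c) * gau z)) z)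
      (nhdsWithin 0 (Set.Ioi 0)) (nhds (∫ z : Fin d → ℝ, (0 : ℝ))) := by
    apply tendsto_integral_filter_of_dominated_convergence (fun z => (|M| + |f c|) * gau z)
    · exact Filter.Eventually.of_forall hmeas
    · exact Filter.Eventually.of_forall fun s => Filter.Eventually.of_forall (hb s)
    · exact gau_integrable.const_mul _
    · refine Filter.Eventually.of_forall fun z => ?_
      have h2 : Filter.Tendsto (fun s : ℝ => ‖(f (c + s • z) - f c) * gau z‖) (nhdsWithin 0 (Set.Ioi 0)) (nhds 0) := by
        have : Filter.Tendsto (fun s : ℝ => ‖(f (c + s • z) - f c) * gau z‖) (nhds 0)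
            (nhds ‖(f (c + (0 : ℝ) • z) - f c) * gau z‖) := by
          apply Continuous.tendsto (f := fun s : ℝ => ‖(f (c + s • z) - f c) * gau z‖); fun_prop
        simp only [zero_smul, add_zero, sub_self, zero_mul, norm_zero] at this
        exact this.mono_left nhdsWithin_le_nhds
      apply squeeze_zero_norm _ h2
      intro s
      exact norm_indicator_le_norm_self _ _
  have h3 := h1.add ((gau_lim Q hQ c ω h).const_mul (f c))
  simp only [integral_zero, zero_add] at h3
  refine h3.congr fun s => ?_
  have hI := (gau_integrable.const_mul (|M| + |f c|)).mono' (hmeas s) (Filter.Eventually.of_forall (hb s))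
  rw [integrable_indicator_iff (hm s)] at hI
  rw [integral_indicator (hm s), ← integral_const_mul, ← integral_add hI (gau_integrable.restrict.const_mul _)]
  congr 1
  ext z
  ring

/-- scaled Gaussian -/
noncomputable def phi {d : ℕ} (s : ℝ) (y : Fin d → ℝ) : ℝ := (s ^ d)⁻¹ * gau (s⁻¹ • y)

lemma phi_eq_prod {d : ℕ} (s : ℝ) (y : Fin d → ℝ) :
    phi s y = ∏ i, (s⁻¹ * Real.exp (-Real.pi * (s⁻¹ * y i) ^ 2)) := by
  rw [phi, gau_eq_prod, Finset.prod_mul_distrib]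
  simp

lemma phi_nonneg {d : ℕ} (s : ℝ) (hs : 0 < s) (y : Fin d → ℝ) : 0 ≤ phi s y := by
  have := gau_pos (s⁻¹ • y)
  unfold phi; positivity

lemma phi_continuous {d : ℕ} (s : ℝ) : Continuous (phi (d := d) s) := by
  have := gau_continuous (d := d)
  unfold phi; fun_prop

lemma phi_subst {d : ℕ} (Q : Set (Fin d → ℝ)) (hQ : MeasurableSet Q) (c : Fin d → ℝ)
    (f : (Fin d → ℝ) → ℝ) (s : ℝ) (hs : 0 < s) :
    ∫ y in Q, f y * phi s (y - c) = ∫ z in {z | c + s • z ∈ Q}, f (c + s • z) * gau z := by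
  have hm : MeasurableSet {z : Fin d → ℝ | c + s • z ∈ Q} :=
    (show Measurable fun z : Fin d → ℝ => c + s • z by fun_prop) hQ
  rw [← integral_indicator hm, ← integral_indicator hQ]
  rw [← integral_add_left_eq_self _ c]
  have := Measure.integral_comp_smul (volume : Measure (Fin d → ℝ))
    (fun z => (s ^ d) * Q.indicator (fun y => f y * phi s (y - c)) (c + z)) s
  rw [Module.finrank_fin_fun, abs_of_pos (by positivity), smul_eq_mul,
    integral_const_mul (s ^ d) (fun z => Q.indicator (fun y => f y * phi s (y - c)) (c + z)),
    inv_mul_cancel_left₀ (by positivity)] at this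
  rw [← this]
  congr 1
  ext z
  by_cases hz : c + s • z ∈ Q
  · rw [Set.indicator_of_mem hz, Set.indicator_of_mem (by exact hz)]
    simp only [phi, add_sub_cancel_left, smul_smul, inv_mul_cancel₀ hs.ne', one_smul]
    field_simp
  · rw [Set.indicator_of_notMem hz, Set.indicator_of_notMem (by exact hz), mul_zero]

lemma phi_integrable {d : ℕ} (s : ℝ) (hs : 0 < s) (c : Fin d → ℝ) :
    Integrable (fun y : Fin d → ℝ => phi s (y - c)) := by
  have h1 : Integrable (fun y : Fin d → ℝ => phi s y) :=
    (gau_integrable.comp_smul (inv_ne_zero hs.ne')).const_mul _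
  exact h1.comp_sub_right c

lemma phi_integral {d : ℕ} (s : ℝ) (hs : 0 < s) (c : Fin d → ℝ) :
    ∫ y : Fin d → ℝ, phi s (y - c) = 1 := by
  have := phi_subst Set.univ MeasurableSet.univ c (fun _ => 1) s hs
  simpa [gau_integral] using this

lemma phi_bound1 (s R : ℝ) (hs : 0 < s) (hs1 : s ≤ 1) (y n : ℝ) (hy : |y| ≤ R) :
    s⁻¹ * Real.exp (-Real.pi * (s⁻¹ * (y - n)) ^ 2) ≤
      ((2 + 2 * R ^ 2) * 2 / (1 + n ^ 2)) *
        ((s * 2)⁻¹ * Real.exp (-Real.pi * ((s * 2)⁻¹ * (y - n)) ^ 2)) := by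
  set t := y - n with ht
  have hR : y ^ 2 ≤ R ^ 2 := sq_le_sq' (by linarith [abs_le.1 hy]) (by linarith [abs_le.1 hy])
  have h1 : 1 + n ^ 2 ≤ (2 + 2 * R ^ 2) * (1 + t ^ 2) := by
    have : n = y - t := by rw [ht]; ring
    rw [this]
    nlinarith [sq_nonneg (y + t), sq_nonneg (R * t)]
  have hinv : 1 ≤ s⁻¹ := (one_le_inv₀ hs).2 hs1
  have h2 : 1 + t ^ 2 ≤ Real.exp (Real.pi * (3 / 4) * (s⁻¹ * t) ^ 2) := by
    refine le_trans ?_ (Real.add_one_le_exp _)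
    have : t ^ 2 ≤ (s⁻¹ * t) ^ 2 := by
      rw [mul_pow]; exact le_mul_of_one_le_left (sq_nonneg _) (one_le_pow₀ hinv)
    nlinarith [Real.pi_gt_three, sq_nonneg (s⁻¹ * t)]
  have h3 : Real.exp (-Real.pi * ((s * 2)⁻¹ * t) ^ 2) =
      Real.exp (-Real.pi * (s⁻¹ * t) ^ 2) * Real.exp (Real.pi * (3 / 4) * (s⁻¹ * t) ^ 2) := by
    rw [← Real.exp_add]; congr 1; rw [mul_inv]; ring
  rw [h3]
  have h4 : 0 < 1 + n ^ 2 := by positivity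
  have h5 : 1 ≤ (2 + 2 * R ^ 2) / (1 + n ^ 2) * Real.exp (Real.pi * (3 / 4) * (s⁻¹ * t) ^ 2) := by
    rw [div_mul_eq_mul_div, le_div_iff₀ h4, one_mul]
    exact h1.trans (mul_le_mul_of_nonneg_left h2 (by positivity))
  calc _ = (s⁻¹ * Real.exp (-Real.pi * (s⁻¹ * t) ^ 2)) * 1 := by ring
    _ ≤ (s⁻¹ * Real.exp (-Real.pi * (s⁻¹ * t) ^ 2)) * _ := mul_le_mul_of_nonneg_left h5 (by positivity)
    _ = _ := by rw [mul_inv]; ring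

lemma phi_bound {d : ℕ} (s R : ℝ) (hs : 0 < s) (hs1 : s ≤ 1) (y n : Fin d → ℝ) (hy : ∀ i, |y i| ≤ R) :
    phi s (y - n) ≤ (∏ i, ((2 + 2 * R ^ 2) * 2 / (1 + n i ^ 2))) * phi (s * 2) (y - n) := by
  rw [phi_eq_prod, phi_eq_prod, ← Finset.prod_mul_distrib]
  apply Finset.prod_le_prod
  · intro i _; positivity
  · intro i _
    exact phi_bound1 s R hs hs1 (y i) (n i) (hy i)

lemma phi_bound_integral {d : ℕ} (s R : ℝ) (hs : 0 < s) (hs1 : s ≤ 1) (n : Fin d → ℝ)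
    (Q : Set (Fin d → ℝ)) (hQ : MeasurableSet Q) (hR : ∀ y ∈ Q, ∀ i, |y i| ≤ R) :
    ∫ y in Q, phi s (y - n) ≤ (∏ i, ((2 + 2 * R ^ 2) * 2 / (1 + n i ^ 2))) := by
  have h2 : 0 < s * 2 := by positivity
  calc _ ≤ ∫ y in Q, (∏ i, ((2 + 2 * R ^ 2) * 2 / (1 + n i ^ 2))) * phi (s * 2) (y - n) := by
        apply setIntegral_mono_on (phi_integrable s hs n).integrableOn
          ((phi_integrable _ h2 n).const_mul _).integrableOn hQ
        intro y hy
        exact phi_bound s R hs hs1 y n (hR y hy)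
    _ ≤ ∫ y, (∏ i, ((2 + 2 * R ^ 2) * 2 / (1 + n i ^ 2))) * phi (s * 2) (y - n) := by
        apply setIntegral_le_integral ((phi_integrable _ h2 n).const_mul _)
        refine Filter.Eventually.of_forall fun y => ?_
        have := phi_nonneg (s * 2) h2 (y - n)
        simp only [Pi.zero_apply]
        positivity
    _ = _ := by rw [integral_const_mul, phi_integral _ h2, mul_one]
lemma pi_prod_tsum {d : ℕ} (f : Fin d → ℤ → ℂ) (hf : ∀ i, Summable (fun n => ‖f i n‖)) :
    Summable (fun ξ : Fin d → ℤ => ‖∏ i, f i (ξ i)‖) ∧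
      ∑' ξ : Fin d → ℤ, ∏ i, f i (ξ i) = ∏ i, ∑' n, f i n := by
  induction d with
  | zero => exact ⟨(hasSum_fintype _).summable, by simp [tsum_fintype]⟩
  | succ d ih =>
    obtain ⟨h1, h2⟩ := ih (fun i => f i.succ) (fun i => hf i.succ)
    have e := Fin.consEquiv (fun _ : Fin (d + 1) => ℤ)
    have key : ∀ p : ℤ × (Fin d → ℤ), ∏ i, f i (Fin.consEquiv (fun _ : Fin (d + 1) => ℤ) p i) =
        f 0 p.1 * ∏ i : Fin d, f i.succ (p.2 i) := by
      intro p
      simp [Fin.prod_univ_succ, Fin.consEquiv]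
    constructor
    · rw [← (Fin.consEquiv (fun _ : Fin (d + 1) => ℤ)).summable_iff]
      have := (hf 0).mul_norm h1
      simpa only [Function.comp_def, key] using this
    · rw [← (Fin.consEquiv (fun _ : Fin (d + 1) => ℤ)).tsum_eq]
      simp only [key]
      rw [← tsum_mul_tsum_of_summable_norm (hf 0) h1, h2, Fin.prod_univ_succ]

lemma theta_norm (ε : ℝ) (y : ℝ) (k : ℤ) :
    ‖Complex.exp (-2 * Real.pi * Complex.I * ((y * k : ℝ) : ℂ)) * (Real.exp (-Real.pi * ε * (k : ℝ) ^ 2) : ℂ)‖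
      = Real.exp (-Real.pi * ε * (k : ℝ) ^ 2) := by
  rw [norm_mul, Complex.norm_real, Real.norm_eq_abs, Real.abs_exp]
  have : (-2 * Real.pi * Complex.I * ((y * k : ℝ) : ℂ)) = ((-2 * Real.pi * (y * k) : ℝ) : ℂ) * Complex.I := by
    push_cast; ring
  rw [this, Complex.norm_exp_ofReal_mul_I, one_mul]

lemma summable_quad : Summable (fun n : ℤ => 1 / (1 + (n : ℝ) ^ 2)) := by
  have h := (Real.summable_one_div_int_add_rpow (1 / 2) 2).2 (by norm_num)
  refine Summable.of_nonneg_of_le (fun n => by positivity) (fun n => ?_) (h.mul_left 4)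
  rw [Real.rpow_two, sq_abs]
  have h0 : (n : ℝ) + 1 / 2 ≠ 0 := by
    intro h
    have h2 : ((2 * n + 1 : ℤ) : ℝ) = 0 := by push_cast; linarith
    have h3 : 2 * n + 1 = 0 := by exact_mod_cast h2
    omega
  have h1 : 0 < ((n : ℝ) + 1 / 2) ^ 2 := by positivity
  rw [mul_one_div, div_le_div_iff₀ (by positivity) h1]
  nlinarith [sq_nonneg ((n : ℝ) - 1 / 2)]

lemma summable_gauss (ε : ℝ) (hε : 0 < ε) (hε1 : ε ≤ 1) :
    Summable (fun k : ℤ => Real.exp (-Real.pi * ε * (k : ℝ) ^ 2)) := by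
  refine Summable.of_nonneg_of_le (fun n => by positivity) (fun k => ?_) (summable_quad.mul_left ε⁻¹)
  have h1 : ε * (1 + (k : ℝ) ^ 2) ≤ Real.exp (Real.pi * ε * (k : ℝ) ^ 2) := by
    refine le_trans ?_ (Real.add_one_le_exp _)
    have : 0 ≤ ε * (k : ℝ) ^ 2 := by positivity
    nlinarith [Real.pi_gt_three]
  have h2 : -Real.pi * ε * (k : ℝ) ^ 2 = -(Real.pi * ε * (k : ℝ) ^ 2) := by ring
  rw [h2, Real.exp_neg, mul_one_div, inv_eq_one_div, inv_eq_one_div, div_div]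
  exact one_div_le_one_div_of_le (by positivity) h1

lemma theta1 (ε : ℝ) (hε : 0 < ε) (y : ℝ) :
    ∑' k : ℤ, Complex.exp (-2 * Real.pi * Complex.I * ((y * k : ℝ) : ℂ)) * (Real.exp (-Real.pi * ε * (k : ℝ) ^ 2) : ℂ)
      = ∑' n : ℤ, (((Real.sqrt ε)⁻¹ * Real.exp (-Real.pi * ((Real.sqrt ε)⁻¹ * (y - n)) ^ 2) : ℝ) : ℂ) := by
  have h := Complex.tsum_exp_neg_quadratic (a := ε) (by simpa using hε) (-Complex.I * y)
  have h1 : ∀ k : ℤ, Complex.exp (-2 * Real.pi * Complex.I * ((y * k : ℝ) : ℂ)) * (Real.exp (-Real.pi * ε * (k : ℝ) ^ 2) : ℂ)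
      = Complex.exp (-Real.pi * ε * k ^ 2 + 2 * Real.pi * (-Complex.I * y) * k) := by
    intro k
    rw [Complex.ofReal_exp, ← Complex.exp_add]
    congr 1
    push_cast; ring
  simp_rw [h1]
  rw [h, ← tsum_mul_left, ← (Equiv.neg ℤ).tsum_eq]
  congr 1
  ext n
  have h2 : ((ε : ℂ) ^ (1 / 2 : ℂ)) = ((Real.sqrt ε : ℝ) : ℂ) := by
    rw [Real.sqrt_eq_rpow, Complex.ofReal_cpow hε.le]
    norm_num
  rw [h2]
  push_cast
  rw [one_div]
  congr 2
  have h3 : (((Real.sqrt ε : ℝ) : ℂ)⁻¹) ^ 2 = (ε : ℂ)⁻¹ := by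
    rw [inv_pow, ← Complex.ofReal_pow, Real.sq_sqrt hε.le]
  rw [mul_pow, h3]
  simp only [Equiv.neg_apply]
  push_cast
  have : Complex.I * (-Complex.I * y) = y := by
    linear_combination (-y : ℂ) * Complex.I_mul_I
  rw [this]
  ring

lemma summable_phi1 (s : ℝ) (hs : 0 < s) (hs1 : s ≤ 1) (y : ℝ) :
    Summable (fun n : ℤ => s⁻¹ * Real.exp (-Real.pi * (s⁻¹ * (y - n)) ^ 2)) := by
  have hq := summable_quad
  refine Summable.of_nonneg_of_le (fun n => by positivity)
    (fun n => phi_bound1 s |y| hs hs1 y n le_rfl) ?_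
  refine Summable.of_nonneg_of_le (fun n => by positivity) (fun n => ?_)
    (hq.mul_left ((2 + 2 * |y| ^ 2) * 2 * (s * 2)⁻¹))
  have : Real.exp (-Real.pi * ((s * 2)⁻¹ * (y - n)) ^ 2) ≤ 1 := by
    rw [Real.exp_le_one_iff]
    nlinarith [Real.pi_pos, sq_nonneg ((s * 2)⁻¹ * (y - n))]
  calc _ ≤ ((2 + 2 * |y| ^ 2) * 2 / (1 + (n : ℝ) ^ 2)) * ((s * 2)⁻¹ * 1) := by gcongr
    _ = _ := by ring

lemma thetad {d : ℕ} (ε : ℝ) (hε : 0 < ε) (hε1 : ε ≤ 1) (y : Fin d → ℝ) :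
    ∑' ξ : Fin d → ℤ, Complex.exp (-2 * Real.pi * Complex.I * ((∑ i, y i * (ξ i : ℝ) : ℝ) : ℂ)) *
        (Real.exp (-Real.pi * ε * ∑ i, (ξ i : ℝ) ^ 2) : ℂ)
      = ∑' n : Fin d → ℤ, ((phi (Real.sqrt ε) (y - fun i => (n i : ℝ)) : ℝ) : ℂ) := by
  have e1 : ∀ ξ : Fin d → ℤ, Complex.exp (-2 * Real.pi * Complex.I * ((∑ i, y i * (ξ i : ℝ) : ℝ) : ℂ)) *
        (Real.exp (-Real.pi * ε * ∑ i, (ξ i : ℝ) ^ 2) : ℂ) =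
      ∏ i, (Complex.exp (-2 * Real.pi * Complex.I * ((y i * (ξ i) : ℝ) : ℂ)) *
        (Real.exp (-Real.pi * ε * (ξ i : ℝ) ^ 2) : ℂ)) := by
    intro ξ
    rw [Finset.prod_mul_distrib, ← Complex.exp_sum, Finset.mul_sum, Real.exp_sum]
    push_cast
    rw [Finset.mul_sum]
  simp_rw [e1]
  rw [(pi_prod_tsum (fun i k => Complex.exp (-2 * Real.pi * Complex.I * ((y i * k : ℝ) : ℂ)) *
        (Real.exp (-Real.pi * ε * (k : ℝ) ^ 2) : ℂ)) (fun i => by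
          simp_rw [theta_norm]; exact summable_gauss ε hε hε1)).2]
  simp_rw [theta1 ε hε]
  rw [← (pi_prod_tsum (fun i n => (((Real.sqrt ε)⁻¹ * Real.exp (-Real.pi * ((Real.sqrt ε)⁻¹ * (y i - n)) ^ 2) : ℝ) : ℂ))
    (fun i => by
      simp_rw [Complex.norm_real]
      exact (summable_phi1 _ (Real.sqrt_pos.2 hε) (Real.sqrt_le_one.2 hε1) (y i)).norm)).2]
  congr 1
  ext n
  rw [phi_eq_prod]
  push_cast
  simp

lemma bern_coeff (k : ℕ) (hk : k ≠ 0) (m : ℤ) :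
    ∫ u in Set.Icc (0 : ℝ) 1, Complex.exp (-2 * Real.pi * Complex.I * ((u * m : ℝ) : ℂ)) *
      ((Polynomial.aeval u (Polynomial.bernoulli k) : ℝ) : ℂ) =
      -(k.factorial : ℂ) / (2 * Real.pi * Complex.I * m) ^ k := by
  rw [← bernoulliFourierCoeff_eq hk m, bernoulliFourierCoeff, fourierCoeffOn_eq_integral,
    intervalIntegral.integral_of_le (by norm_num), integral_Icc_eq_integral_Ioc]
  simp only [sub_zero, ne_eq, one_ne_zero, not_false_eq_true, div_self, one_smul]
  congr 1
  ext u
  rw [smul_eq_mul, fourier_coe_apply, bernoulliFun, Polynomial.eval_map_algebraMap]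
  congr 2
  push_cast
  ring_nf
  

lemma bern_coeff_d {d : ℕ} (e : Fin d → ℕ) (he : ∀ j, 1 ≤ e j) (m : Fin d → ℤ) :
    ∫ u in Set.Icc (0 : Fin d → ℝ) 1, Complex.exp (-2 * Real.pi * Complex.I * ((∑ j, u j * m j : ℝ) : ℂ)) *
      ((∏ j, Polynomial.aeval (u j) (Polynomial.bernoulli (e j)) : ℝ) : ℂ) =
      ∏ j, (-((e j).factorial : ℂ) / (2 * Real.pi * Complex.I * m j) ^ (e j)) := by
  have h1 : (volume.restrict (Set.Icc (0 : Fin d → ℝ) 1)) =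
      Measure.pi (fun _ : Fin d => volume.restrict (Set.Icc (0 : ℝ) 1)) := by
    rw [← Set.pi_univ_Icc, volume_pi, Measure.restrict_pi_pi]
    rfl
  rw [h1]
  have h2 : ∀ u : Fin d → ℝ, Complex.exp (-2 * Real.pi * Complex.I * ((∑ j, u j * m j : ℝ) : ℂ)) *
      ((∏ j, Polynomial.aeval (u j) (Polynomial.bernoulli (e j)) : ℝ) : ℂ) =
      ∏ j, (Complex.exp (-2 * Real.pi * Complex.I * ((u j * m j : ℝ) : ℂ)) *
      ((Polynomial.aeval (u j) (Polynomial.bernoulli (e j)) : ℝ) : ℂ)) := by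
    intro u
    rw [Finset.prod_mul_distrib, ← Complex.exp_sum]
    push_cast
    rw [Finset.mul_sum]
  simp_rw [h2]
  rw [integral_fintype_prod_eq_prod (fun j (u : ℝ) => Complex.exp (-2 * Real.pi * Complex.I * ((u * m j : ℝ) : ℂ)) *
      ((Polynomial.aeval u (Polynomial.bernoulli (e j)) : ℝ) : ℂ))]
  exact Finset.prod_congr rfl fun j _ => bern_coeff (e j) (by have := he j; omega) (m j)
lemma summable_pi_quad {d : ℕ} (K : ℝ) :
    Summable (fun n : Fin d → ℤ => ∏ i, (K / (1 + (n i : ℝ) ^ 2))) := by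
  have h := (pi_prod_tsum (d := d) (fun _ n => ((K / (1 + (n : ℝ) ^ 2) : ℝ) : ℂ)) (fun i => by
    simp_rw [Complex.norm_real]
    have := (summable_quad.mul_left K).norm
    simpa only [mul_one_div] using this)).1
  simp_rw [← Complex.ofReal_prod, Complex.norm_real] at h
  exact h.of_norm

lemma summable_pi_gauss {d : ℕ} (ε : ℝ) (hε : 0 < ε) (hε1 : ε ≤ 1) :
    Summable (fun k : Fin d → ℤ => Real.exp (-Real.pi * ε * ∑ i, (k i : ℝ) ^ 2)) := by
  have h := (pi_prod_tsum (d := d) (fun _ k => ((Real.exp (-Real.pi * ε * (k : ℝ) ^ 2) : ℝ) : ℂ)) (fun i => by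
    simp_rw [Complex.norm_real]
    exact (summable_gauss ε hε hε1).norm)).1
  simp_rw [← Complex.ofReal_prod, Complex.norm_real, ← Real.exp_sum, ← Finset.mul_sum] at h
  exact h.of_norm

/-- the Bernoulli product pulled back to the parallelepiped -/
noncomputable def hB {d : ℕ} (A : Matrix (Fin d) (Fin d) ℝ) (e : Fin d → ℕ) (x y : Fin d → ℝ) : ℝ :=
  ∏ i, Polynomial.aeval ((A⁻¹ *ᵥ (y - x)) i) (Polynomial.bernoulli (e i))

lemma hB_continuous {d : ℕ} (A : Matrix (Fin d) (Fin d) ℝ) (e : Fin d → ℕ) (x : Fin d → ℝ) :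
    Continuous (hB A e x) := by
  unfold hB
  apply continuous_finsetProd
  intro i _
  apply (Polynomial.continuous_aeval _).comp
  apply (continuous_apply i).comp
  exact Continuous.matrix_mulVec continuous_const (by fun_prop)

lemma para_image {d : ℕ} (A : Matrix (Fin d) (Fin d) ℝ) (hA : A.det ≠ 0) (x : Fin d → ℝ) :
    {n | ∀ i, (A⁻¹ *ᵥ (n - x)) i ∈ Set.Icc (0 : ℝ) 1} = (fun u => x + A *ᵥ u) '' Set.Icc 0 1 := by
  have hu : IsUnit A.det := isUnit_iff_ne_zero.2 hA
  ext y
  simp only [Set.mem_ofPred_eq, Set.mem_image]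
  constructor
  · intro h
    refine ⟨A⁻¹ *ᵥ (y - x), ⟨fun i => (h i).1, fun i => (h i).2⟩, ?_⟩
    rw [Matrix.mulVec_mulVec, Matrix.mul_nonsing_inv A hu, Matrix.one_mulVec]
    simp
  · rintro ⟨u, hu1, rfl⟩ i
    rw [add_sub_cancel_left, Matrix.mulVec_mulVec, Matrix.nonsing_inv_mul A hu, Matrix.one_mulVec]
    exact ⟨hu1.1 i, hu1.2 i⟩

lemma coeff_para {d : ℕ} (W : Matrix (Fin d) (Fin d) ℤ)
    (hW : (W.map (Int.cast : ℤ → ℝ)).det ≠ 0) (e : Fin d → ℕ) (he : ∀ j, 1 ≤ e j) (x : Fin d → ℝ)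
    (ξ : Fin d → ℤ) :
    ∫ y in (fun u => x + (W.map (Int.cast : ℤ → ℝ)) *ᵥ u) '' Set.Icc 0 1,
      Complex.exp (-2 * Real.pi * Complex.I * ((∑ i, y i * (ξ i : ℝ) : ℝ) : ℂ)) *
        ((hB (W.map (Int.cast : ℤ → ℝ)) e x y : ℝ) : ℂ) =
    ((|(W.map (Int.cast : ℤ → ℝ)).det| : ℝ) : ℂ) *
      (Complex.exp (-2 * Real.pi * Complex.I * ((∑ i, x i * (ξ i : ℝ) : ℝ) : ℂ)) *
      ∏ j, (-((e j).factorial : ℂ) / (2 * Real.pi * Complex.I * ((∑ i, W i j * ξ i : ℤ) : ℂ)) ^ (e j))) := by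
  set A := W.map (Int.cast : ℤ → ℝ) with hAdef
  have hu : IsUnit A.det := isUnit_iff_ne_zero.2 hW
  have hinv : ∀ u, A⁻¹ *ᵥ (x + A *ᵥ u - x) = u := by
    intro u
    rw [add_sub_cancel_left, Matrix.mulVec_mulVec, Matrix.nonsing_inv_mul A hu, Matrix.one_mulVec]
  rw [integral_image_eq_integral_abs_det_fderiv_smul volume measurableSet_Icc
    (f' := fun _ => (Matrix.toLin' A).toContinuousLinearMap)]
  · simp only [Complex.real_smul]
    rw [← bern_coeff_d e he (fun j => ∑ i, W i j * ξ i), ← integral_const_mul, ← integral_const_mul]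
    congr 1
    ext u
    have hdet : ((Matrix.toLin' A).toContinuousLinearMap).det = A.det := by
      simp [ContinuousLinearMap.det]
    rw [hdet, hB, hinv]
    have hexp : (∑ i, (x + A *ᵥ u) i * (ξ i : ℝ)) = (∑ i, x i * (ξ i : ℝ)) +
        ∑ j, u j * ((∑ i, W i j * ξ i : ℤ) : ℝ) := by
      simp only [Pi.add_apply, add_mul, Finset.sum_add_distrib]
      congr 1
      simp only [Matrix.mulVec, dotProduct, hAdef, Matrix.map_apply, Finset.sum_mul]
      rw [Finset.sum_comm]
      push_cast
      simp only [Finset.mul_sum]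
      refine Finset.sum_congr rfl fun j _ => Finset.sum_congr rfl fun i _ => by ring
    rw [hexp, Complex.ofReal_add, mul_add, Complex.exp_add]
    ring
  · intro u _
    apply HasFDerivAt.hasFDerivWithinAt
    exact ((Matrix.toLin' A).toContinuousLinearMap.hasFDerivAt).const_add x
  · intro u _ v _ huv
    have := congrArg (fun y => A⁻¹ *ᵥ (y - x)) huv
    simpa only [hinv] using this

lemma term_eq {d : ℕ} (m : Fin d → ℤ) (e : Fin d → ℕ) (he : ∀ j, 1 ≤ e j) (D : ℝ) (hD : D ≠ 0) (a b : ℂ) :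
    (1 / (2 * Real.pi * Complex.I) ^ (∑ j, e j)) *
      (if (∀ j, m j ≠ 0) then a * b / ∏ j, (m j : ℂ) ^ (e j) else 0) =
    (((-1 : ℝ) ^ d / ((∏ j, ((e j).factorial : ℝ)) * D) : ℝ) : ℂ) *
      (b * (D * (a * ∏ j, (-((e j).factorial : ℂ) / (2 * Real.pi * Complex.I * (m j : ℂ)) ^ (e j))))) := by
  have hD' : (D : ℂ) ≠ 0 := by exact_mod_cast hD
  split_ifs with h
  · have h1 : ∏ j, (-((e j).factorial : ℂ) / (2 * Real.pi * Complex.I * (m j : ℂ)) ^ (e j)) =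
        (-1) ^ d * (∏ j, ((e j).factorial : ℂ)) / ((2 * Real.pi * Complex.I) ^ (∑ j, e j) * ∏ j, (m j : ℂ) ^ (e j)) := by
      rw [Finset.prod_div_distrib, Finset.prod_neg, Finset.card_univ, Fintype.card_fin]
      simp_rw [mul_pow]
      rw [Finset.prod_mul_distrib, Finset.prod_mul_distrib, Finset.prod_mul_distrib,
        Finset.prod_pow_eq_pow_sum, Finset.prod_pow_eq_pow_sum, Finset.prod_pow_eq_pow_sum]
    rw [h1]
    have h2 : ∏ j, ((e j).factorial : ℂ) ≠ 0 :=
      Finset.prod_ne_zero_iff.2 fun j _ => by exact_mod_cast (e j).factorial_ne_zero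
    have h3 : ∏ j, (m j : ℂ) ^ (e j) ≠ 0 :=
      Finset.prod_ne_zero_iff.2 fun j _ => pow_ne_zero _ (by exact_mod_cast h j)
    have h4 : (2 * Real.pi * Complex.I : ℂ) ≠ 0 := Complex.two_pi_I_ne_zero
    have h5 : ((-1 : ℂ) ^ d) * (-1) ^ d = 1 := by rw [← mul_pow]; simp
    push_cast
    generalize (2 * Real.pi * Complex.I : ℂ) = T at *
    generalize ∏ j, ((e j).factorial : ℂ) = F at *
    generalize ∏ j, (m j : ℂ) ^ (e j) = N at *
    generalize (-1 : ℂ) ^ d = S at *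
    field_simp
    linear_combination (-(a * b)) * h5
  · push Not at h
    obtain ⟨j, hj⟩ := h
    have : ∏ j, (-((e j).factorial : ℂ) / (2 * Real.pi * Complex.I * (m j : ℂ)) ^ (e j)) = 0 := by
      apply Finset.prod_eq_zero (Finset.mem_univ j)
      have := he j
      rw [hj]; simp; omega
    rw [this]; simp

lemma swap_all {d : ℕ} (P : Set (Fin d → ℝ)) (hP : IsCompact P) (h : (Fin d → ℝ) → ℝ) (hh : Continuous h)
    (R M : ℝ) (hR : ∀ y ∈ P, ∀ i, |y i| ≤ R) (hM : ∀ y ∈ P, |h y| ≤ M)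
    (ε : ℝ) (hε : 0 < ε) (hε1 : ε ≤ 1) :
    ∑' ξ : Fin d → ℤ, (Real.exp (-Real.pi * ε * ∑ i, (ξ i : ℝ) ^ 2) : ℂ) *
      ∫ y in P, Complex.exp (-2 * Real.pi * Complex.I * ((∑ i, y i * (ξ i : ℝ) : ℝ) : ℂ)) * ((h y : ℝ) : ℂ) =
    ((∑' n : Fin d → ℤ, ∫ y in P, h y * phi (Real.sqrt ε) (y - fun i => (n i : ℝ)) : ℝ) : ℂ) := by
  have hs : 0 < Real.sqrt ε := Real.sqrt_pos.2 hε
  have hs1 : Real.sqrt ε ≤ 1 := Real.sqrt_le_one.2 hε1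
  have hPm := hP.measurableSet
  have hexp : ∀ (y : Fin d → ℝ) (ξ : Fin d → ℤ),
      ‖Complex.exp (-2 * Real.pi * Complex.I * ((∑ i, y i * (ξ i : ℝ) : ℝ) : ℂ))‖ = 1 := by
    intro y ξ
    have : (-2 * Real.pi * Complex.I * ((∑ i, y i * (ξ i : ℝ) : ℝ) : ℂ)) =
        ((-2 * Real.pi * (∑ i, y i * (ξ i : ℝ)) : ℝ) : ℂ) * Complex.I := by
      push_cast; ring
    rw [this, Complex.norm_exp_ofReal_mul_I]
  have s1 := hasSum_integral_of_summable_integral_norm (μ := volume.restrict P)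
    (F := fun (ξ : Fin d → ℤ) y => (Real.exp (-Real.pi * ε * ∑ i, (ξ i : ℝ) ^ 2) : ℂ) *
      (Complex.exp (-2 * Real.pi * Complex.I * ((∑ i, y i * (ξ i : ℝ) : ℝ) : ℂ)) * ((h y : ℝ) : ℂ)))
    (fun ξ => by
      apply ContinuousOn.integrableOn_compact hP
      apply Continuous.continuousOn
      fun_prop)
    (by
      simp_rw [norm_mul, hexp, Complex.norm_real, one_mul, integral_const_mul]
      simp only [Real.norm_eq_abs, Real.abs_exp]
      exact (summable_pi_gauss ε hε hε1).mul_right _)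
  simp_rw [integral_const_mul] at s1
  rw [s1.tsum_eq]
  have s2 := hasSum_integral_of_summable_integral_norm (μ := volume.restrict P)
    (F := fun (n : Fin d → ℤ) y => ((h y * phi (Real.sqrt ε) (y - fun i => (n i : ℝ)) : ℝ) : ℂ))
    (fun n => by
      apply ContinuousOn.integrableOn_compact hP
      apply Continuous.continuousOn
      have := phi_continuous (d := d) (Real.sqrt ε)
      fun_prop)
    (by
      refine Summable.of_nonneg_of_le (fun n => integral_nonneg fun y => norm_nonneg _) (fun n => ?_)
        ((summable_pi_quad ((2 + 2 * R ^ 2) * 2)).mul_left |M|)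
      refine le_trans ?_ (mul_le_mul_of_nonneg_left
        (phi_bound_integral (Real.sqrt ε) R hs hs1 (fun i => (n i : ℝ)) P hPm hR) (abs_nonneg M))
      rw [← integral_const_mul]
      apply setIntegral_mono_on _ _ hPm
      · intro y hy
        rw [Complex.norm_real, norm_mul, Real.norm_eq_abs, Real.norm_eq_abs, abs_of_nonneg (phi_nonneg _ hs _)]
        exact mul_le_mul_of_nonneg_right ((hM y hy).trans (le_abs_self M)) (phi_nonneg _ hs _)
      · apply ContinuousOn.integrableOn_compact hP
        apply Continuous.continuousOn
        have := phi_continuous (d := d) (Real.sqrt ε)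
        fun_prop
      · exact ((phi_integrable _ hs _).const_mul _).integrableOn)
  simp only [integral_complex_ofReal] at s2
  rw [Complex.ofReal_tsum, s2.tsum_eq]
  congr 1
  ext y
  have := thetad ε hε hε1 y
  simp_rw [Complex.ofReal_mul]
  rw [tsum_mul_left, ← this, ← tsum_mul_left]
  congr 1
  ext ξ
  ring

/-- Gaussian-regularized lattice sum over `ℤ^d` of `e^{-2πi⟨x,ξ⟩}/∏⟨w_j,ξ⟩^{e_j}` equals a
finite sum of Bernoulli polynomials weighted by solid angles over the lattice points of the
parallelepiped `P_{W,x} = x + W[0,1]^d`. -/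
theorem lattice_sum_formula (d : ℕ) (W : Matrix (Fin d) (Fin d) ℤ)
    (hW : (W.map (Int.cast : ℤ → ℝ)).det ≠ 0)
    (e : Fin d → ℕ) (he : ∀ j, 1 ≤ e j) (x : Fin d → ℝ)
    (PWx : Set (Fin d → ℝ))
    (hPWx : PWx = {n | ∀ i, ((W.map (Int.cast : ℤ → ℝ))⁻¹ *ᵥ (n - x)) i ∈ Set.Icc (0 : ℝ) 1})
    (ω : (Fin d → ℤ) → ℝ)
    (hω : ∀ n : Fin d → ℤ, saTendsto PWx (fun i => (n i : ℝ)) (ω n)) :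
    Filter.Tendsto
      (fun ε : ℝ =>
        (1 / (2 * Real.pi * Complex.I) ^ (∑ j, e j)) *
          ∑' ξ : Fin d → ℤ,
            if (∀ j, (∑ i, W i j * ξ i) ≠ 0) then
              Complex.exp (-2 * Real.pi * Complex.I * ((∑ i, x i * (ξ i : ℝ) : ℝ) : ℂ)) *
                Real.exp (-Real.pi * ε * (∑ i, (ξ i : ℝ) ^ 2)) /
                  ∏ j, ((∑ i, W i j * ξ i : ℤ) : ℂ) ^ (e j)
            else 0)
      (nhdsWithin 0 (Set.Ioi 0))
      (nhds ((((-1 : ℝ) ^ d / ((∏ j, ((e j).factorial : ℝ)) * |(W.map (Int.cast : ℤ → ℝ)).det|)) *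
        ∑' n : Fin d → ℤ,
          (∏ i, bernTrunc (e i)
            (((W.map (Int.cast : ℤ → ℝ))⁻¹ *ᵥ ((fun i => (n i : ℝ)) - x)) i)) * ω n : ℝ) : ℂ)) := by
  set A := W.map (Int.cast : ℤ → ℝ) with hAdef
  have hPim := hPWx.trans (para_image A hW x)
  have hcompact : IsCompact PWx := by
    rw [hPim]
    apply isCompact_Icc.image
    exact continuous_const.add (Continuous.matrix_mulVec continuous_const continuous_id)
  have hPm := hcompact.measurableSet
  have hc := hB_continuous A e x
  obtain ⟨R, hR⟩ := hcompact.exists_bound_of_continuousOn (f := fun y : Fin d → ℝ => y) continuousOn_id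
  obtain ⟨M, hM⟩ := hcompact.exists_bound_of_continuousOn (f := hB A e x) hc.continuousOn
  have hR' : ∀ y ∈ PWx, ∀ i, |y i| ≤ R := fun y hy i => (norm_le_pi_norm y i).trans (hR y hy)
  have hM' : ∀ y ∈ PWx, |hB A e x y| ≤ M := fun y hy => hM y hy
  have hD : |A.det| ≠ 0 := abs_ne_zero.2 hW
  have hval : ∀ n : Fin d → ℤ, (∏ i, bernTrunc (e i) ((A⁻¹ *ᵥ ((fun i => (n i : ℝ)) - x)) i)) * ω n =
      hB A e x (fun i => (n i : ℝ)) * ω n := by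
    intro n
    by_cases hn : (fun i => (n i : ℝ)) ∈ PWx
    · rw [hB]
      congr 1
      refine Finset.prod_congr rfl fun i _ => ?_
      rw [hPWx] at hn
      rw [bernTrunc, if_pos (hn i)]
    · have h0 : ω n = 0 := by
        have hlim2 := hω n
        refine tendsto_nhds_unique hlim2 ?_
        have hopen : PWxᶜ ∈ nhds (fun i => (n i : ℝ)) := hcompact.isClosed.isOpen_compl.mem_nhds hn
        obtain ⟨r, hr, hrs⟩ := Metric.mem_nhds_iff.1 hopen
        apply tendsto_const_nhds.congr'
        filter_upwards [Ioo_mem_nhdsGT hr] with δ hδ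
        have : eball (fun i => (n i : ℝ)) δ ∩ PWx = ∅ := by
          ext y
          simp only [Set.mem_inter_iff, Set.mem_empty_iff_false, iff_false, not_and]
          intro hy
          apply hrs
          rw [Metric.mem_ball, dist_eq_norm]
          refine lt_of_le_of_lt ?_ hδ.2
          rw [pi_norm_le_iff_of_nonneg hδ.1.le]
          intro i
          have h1 : (y i - (n i : ℝ)) ^ 2 ≤ ∑ i, (y i - (n i : ℝ)) ^ 2 :=
            Finset.single_le_sum (f := fun i => (y i - (n i : ℝ)) ^ 2) (fun i _ => sq_nonneg _) (Finset.mem_univ i)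
          have h2 : ∑ i, (y i - (n i : ℝ)) ^ 2 < δ ^ 2 := hy
          exact abs_le_of_sq_le_sq (h1.trans h2.le) hδ.1.le
        rw [this]; simp
      rw [h0, mul_zero, mul_zero]
  simp_rw [hval]
  have hsum : Filter.Tendsto (fun ε : ℝ => ∑' n : Fin d → ℤ,
      ∫ y in PWx, hB A e x y * phi (Real.sqrt ε) (y - fun i => (n i : ℝ)))
      (nhdsWithin 0 (Set.Ioi 0)) (nhds (∑' n : Fin d → ℤ, hB A e x (fun i => (n i : ℝ)) * ω n)) := by
    have hsq : Filter.Tendsto Real.sqrt (nhdsWithin 0 (Set.Ioi 0)) (nhdsWithin 0 (Set.Ioi 0)) := by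
      apply tendsto_nhdsWithin_iff.2
      constructor
      · have := Real.continuous_sqrt.tendsto 0
        rw [Real.sqrt_zero] at this
        exact this.mono_left nhdsWithin_le_nhds
      · filter_upwards [self_mem_nhdsWithin] with s hs
        exact Real.sqrt_pos.2 hs
    apply tendsto_tsum_of_dominated_convergence ((summable_pi_quad ((2 + 2 * R ^ 2) * 2)).mul_left |M|)
    · intro n
      have h1 := (gau_lim_fun PWx hPm _ _ (hω n) (hB A e x) hc M hM').comp hsq
      refine h1.congr' ?_
      filter_upwards [self_mem_nhdsWithin] with ε hε
      exact (phi_subst PWx hPm _ (hB A e x) _ (Real.sqrt_pos.2 hε)).symm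
    · filter_upwards [Ioc_mem_nhdsGT (zero_lt_one' ℝ)] with ε hε n
      have hs : 0 < Real.sqrt ε := Real.sqrt_pos.2 hε.1
      refine le_trans ?_ (mul_le_mul_of_nonneg_left
        (phi_bound_integral (Real.sqrt ε) R hs (Real.sqrt_le_one.2 hε.2) (fun i => (n i : ℝ)) PWx hPm hR') (abs_nonneg M))
      rw [← integral_const_mul]
      apply norm_integral_le_of_norm_le ((phi_integrable _ hs _).const_mul _).integrableOn
      filter_upwards [self_mem_ae_restrict hPm] with y hy
      rw [norm_mul, Real.norm_eq_abs, Real.norm_eq_abs, abs_of_nonneg (phi_nonneg _ hs _)]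
      exact mul_le_mul_of_nonneg_right ((hM' y hy).trans (le_abs_self M)) (phi_nonneg _ hs _)
  have hfin := (Complex.continuous_ofReal.tendsto _).comp
    (hsum.const_mul ((-1 : ℝ) ^ d / ((∏ j, ((e j).factorial : ℝ)) * |A.det|)))
  refine hfin.congr' ?_
  filter_upwards [Ioc_mem_nhdsGT (zero_lt_one' ℝ)] with ε hε
  simp only [Function.comp]
  rw [Complex.ofReal_mul, ← swap_all PWx hcompact (hB A e x) hc R M hR' hM' ε hε.1 hε.2,
    ← tsum_mul_left, ← tsum_mul_left]
  congr 1
  ext ξ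
  rw [term_eq (fun j => ∑ i, W i j * ξ i) e he |A.det| hD, hPim, coeff_para W hW e he x ξ]
end

section
/- Let Δ ⊂ ℝ³ be the standard simplex with vertices (0,0,0), (1,0,0), (0,1,0), (0,0,1). For all positive real t, the solid angle sum satisfies A_Δ(t) = (1/6)t³ - (1/2)B̄₁(t)t² + ( (1/2)B̄₂(t) + ( (3/(2π))·arccos(1/√3) - 3/4 )·1_ℤ(t) + 1/4 )·t - B̄₁(t)·( (1/6)B̄₂(t) + 2/9 ). -/
open scoped BigOperators
open MeasureTheory
attribute [local instance] Classical.propDecidable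

open Pointwise

/-- Periodized first Bernoulli polynomial. -/
noncomputable def B1bar (x : ℝ) : ℝ := if ∃ n : ℤ, x = n then 0 else Int.fract x - 1/2

/-- Periodized second Bernoulli polynomial. -/
noncomputable def B2bar (x : ℝ) : ℝ := (Int.fract x)^2 - Int.fract x + 1/6

/-- Indicator function of the integers. -/
noncomputable def indZ (x : ℝ) : ℝ := if ∃ n : ℤ, x = n then 1 else 0

/-- The standard simplex in `ℝ³`. -/
noncomputable def stdSimplex3 : Set (Fin 3 → ℝ) :=
  convexHull ℝ {![0,0,0], ![1,0,0], ![0,1,0], ![0,0,1]}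


noncomputable def nuB (ε : ℝ) (S : Set (Fin 3 → ℝ)) : ℝ := (volume (eball (0 : Fin 3 → ℝ) ε ∩ S)).toReal

lemma eball_open {d : ℕ} (c : Fin d → ℝ) (ε : ℝ) : IsOpen (eball c ε) := by
  unfold eball
  exact isOpen_lt (by fun_prop) (by fun_prop)

lemma eball_sub (c : Fin 3 → ℝ) {ε : ℝ} (hε : 0 < ε) : eball c ε ⊆ Metric.ball c ε := by
  intro y hy
  simp only [eball, Fin.sum_univ_three, Set.mem_ofPred_eq] at hy
  rw [mem_ball_iff_norm, pi_norm_lt_iff hε]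
  intro i
  rw [Real.norm_eq_abs]
  apply abs_lt_of_sq_lt_sq _ hε.le
  fin_cases i <;> simp <;> nlinarith [sq_nonneg (y 0 - c 0), sq_nonneg (y 1 - c 1), sq_nonneg (y 2 - c 2)]

lemma eball_fin (c : Fin 3 → ℝ) {ε : ℝ} (hε : 0 < ε) : volume (eball c ε) ≠ ⊤ :=
  (lt_of_le_of_lt (measure_mono (eball_sub c hε)) measure_ball_lt_top).ne

lemma eball_pos_s12 (c : Fin 3 → ℝ) {ε : ℝ} (hε : 0 < ε) : 0 < (volume (eball c ε)).toReal := by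
  apply ENNReal.toReal_pos _ (eball_fin c hε)
  apply ((eball_open c ε).measure_pos volume ⟨c, _⟩).ne'
  simp only [eball, Set.mem_ofPred_eq]
  simp
  positivity

lemma nu_fin {ε : ℝ} (hε : 0 < ε) (S : Set (Fin 3 → ℝ)) : volume (eball (0 : Fin 3 → ℝ) ε ∩ S) ≠ ⊤ :=
  (lt_of_le_of_lt (measure_mono Set.inter_subset_left) (eball_fin 0 hε).lt_top).ne

/-- translation -/
lemma vol_translate (c : Fin 3 → ℝ) (ε : ℝ) (S : Set (Fin 3 → ℝ)) :
    (volume (eball c ε ∩ S)).toReal = nuB ε {x | x + c ∈ S} := by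
  unfold nuB
  rw [← measure_preimage_add_right volume c (eball c ε ∩ S)]
  congr 2
  ext x
  simp [eball]

lemma nu_orth (M : Matrix (Fin 3) (Fin 3) ℝ) (hdet : |M.det| = 1)
    (hM : ∀ x : Fin 3 → ℝ, ∑ i, (M.mulVec x i) ^ 2 = ∑ i, (x i) ^ 2) (ε : ℝ) (S : Set (Fin 3 → ℝ)) :
    nuB ε {x | M.mulVec x ∈ S} = nuB ε S := by
  have hd : LinearMap.det (Matrix.toLin' M) = M.det := LinearMap.det_toLin' M
  have h0 : LinearMap.det (Matrix.toLin' M) ≠ 0 := by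
    rw [hd]; intro h; rw [h] at hdet; simp at hdet
  have := Measure.addHaar_preimage_linearMap volume h0 (eball (0 : Fin 3 → ℝ) ε ∩ S)
  rw [hd, abs_inv, hdet] at this
  simp only [inv_one, ENNReal.ofReal_one, one_mul] at this
  unfold nuB
  rw [← this]
  congr 2
  ext x
  simp only [eball, Set.mem_inter_iff, Set.mem_ofPred_eq, Set.mem_preimage, Matrix.toLin'_apply, Pi.zero_apply, sub_zero, hM]

lemma hyper_null (a : Fin 3 → ℝ) (i : Fin 3) (ha : a i ≠ 0) :
    volume {x : Fin 3 → ℝ | ∑ j, a j * x j = 0} = 0 := by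
  let f : (Fin 3 → ℝ) →ₗ[ℝ] ℝ := ∑ j, (a j) • LinearMap.proj j
  have hf : ∀ x, f x = ∑ j, a j * x j := by intro x; simp [f]
  have := Measure.addHaar_submodule volume (LinearMap.ker f) (by
    intro h
    have : Pi.single i 1 ∈ LinearMap.ker f := by rw [h]; trivial
    rw [LinearMap.mem_ker, hf] at this
    simp [Pi.single_apply] at this
    exact ha this)
  rw [← this]
  rfl

/-- splitting along a hyperplane -/
lemma nu_split {ε : ℝ} (hε : 0 < ε) (a : Fin 3 → ℝ) (i : Fin 3) (ha : a i ≠ 0) (S : Set (Fin 3 → ℝ)) :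
    nuB ε S = nuB ε (S ∩ {x | 0 ≤ ∑ j, a j * x j}) + nuB ε (S ∩ {x | ∑ j, a j * x j ≤ 0}) := by
  have hm : MeasurableSet {x : Fin 3 → ℝ | 0 ≤ ∑ j, a j * x j} := measurableSet_le (by fun_prop) (by fun_prop)
  unfold nuB
  rw [← ENNReal.toReal_add (nu_fin hε _) (nu_fin hε _),
    ← measure_inter_add_sdiff (eball (0 : Fin 3 → ℝ) ε ∩ S) hm, Set.inter_assoc]
  congr 2
  apply le_antisymm
  · apply measure_mono
    rintro x ⟨⟨h1, h2⟩, h3⟩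
    simp only [Set.mem_ofPred_eq, not_le] at h3
    exact ⟨h1, h2, h3.le⟩
  · have : eball (0 : Fin 3 → ℝ) ε ∩ (S ∩ {x | ∑ j, a j * x j ≤ 0}) ⊆
      ((eball (0 : Fin 3 → ℝ) ε ∩ S) \ {x : Fin 3 → ℝ | 0 ≤ ∑ j, a j * x j}) ∪ {x : Fin 3 → ℝ | ∑ j, a j * x j = 0} := by
      rintro x ⟨h1, h2, h3⟩
      by_cases h : ∑ j, a j * x j = 0
      · right; exact h
      · left
        refine ⟨⟨h1, h2⟩, ?_⟩
        simp only [Set.mem_ofPred_eq, not_le] at h3 ⊢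
        exact lt_of_le_of_ne h3 h
    calc _ ≤ _ := measure_mono this
      _ ≤ _ := measure_union_le _ _
      _ = _ := by rw [hyper_null a i ha, add_zero]

lemma sector_iff {φ : ℝ} (h1 : -Real.pi < φ) (h2 : φ < Real.pi) :
    (0 ≤ Real.sin φ ∧ Real.sin φ ≤ Real.sqrt 2 * Real.cos φ) ↔ φ ∈ Set.Icc 0 (Real.arccos (1 / Real.sqrt 3)) := by
  set θ := Real.arccos (1 / Real.sqrt 3) with hθ
  have h3 : (0:ℝ) < Real.sqrt 3 := by positivity
  have h3' : Real.sqrt 3 ^ 2 = 3 := Real.sq_sqrt (by norm_num)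
  have hle : 1 / Real.sqrt 3 ≤ 1 := by
    rw [div_le_one h3]; nlinarith
  have hpos : 0 < 1 / Real.sqrt 3 := by positivity
  have hc : Real.cos θ = 1 / Real.sqrt 3 := Real.cos_arccos (by linarith) hle
  have hs : Real.sin θ = Real.sqrt 2 / Real.sqrt 3 := by
    rw [hθ, Real.sin_arccos, ← Real.sqrt_div (by norm_num)]
    congr 1
    rw [div_pow, h3']; norm_num
  have hsin : Real.sqrt 3 * Real.sin (θ - φ) = Real.sqrt 2 * Real.cos φ - Real.sin φ := by
    rw [Real.sin_sub, hc, hs]; field_simp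
  have hθ0 : 0 ≤ θ := Real.arccos_nonneg _
  have hθ1 : θ ≤ Real.pi / 2 := by
    rw [hθ, Real.arccos_le_pi_div_two]; positivity
  constructor
  · rintro ⟨ha, hb⟩
    have hφ : 0 ≤ φ := by
      by_contra h
      push Not at h
      have := Real.sin_neg_of_neg_of_neg_pi_lt h h1
      linarith
    refine ⟨hφ, ?_⟩
    by_contra h
    push Not at h
    have := Real.sin_neg_of_neg_of_neg_pi_lt (x := θ - φ) (by linarith) (by linarith)
    nlinarith
  · rintro ⟨ha, hb⟩
    have hp := Real.pi_pos
    refine ⟨Real.sin_nonneg_of_nonneg_of_le_pi ha (by linarith), ?_⟩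
    have := Real.sin_nonneg_of_nonneg_of_le_pi (x := θ - φ) (by linarith) (by linarith)
    nlinarith

lemma wedge_meas : MeasurableSet {p : ℝ × ℝ | 0 ≤ p.2 ∧ p.2 ≤ Real.sqrt 2 * p.1} := by
  have h1 : MeasurableSet {p : ℝ × ℝ | 0 ≤ p.2} := measurableSet_le (by fun_prop) (by fun_prop)
  have h2 : MeasurableSet {p : ℝ × ℝ | p.2 ≤ Real.sqrt 2 * p.1} := measurableSet_le (by fun_prop) (by fun_prop)
  exact h1.inter h2

lemma polar_vol (ρ : ℝ) (S : Set (ℝ × ℝ)) (hS : MeasurableSet S) (I : Set ℝ) (hI : MeasurableSet I)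
    (h : ∀ r φ : ℝ, 0 < r → -Real.pi < φ → φ < Real.pi →
      ((r * Real.cos φ, r * Real.sin φ) ∈ S ↔ φ ∈ I)) :
    volume ({p : ℝ × ℝ | p.1 ^ 2 + p.2 ^ 2 < ρ} ∩ S) =
      (∫⁻ r in Set.Ioi (0:ℝ), ENNReal.ofReal r * {r : ℝ | r ^ 2 < ρ}.indicator 1 r) *
        volume (I ∩ Set.Ioo (-Real.pi) Real.pi) := by
  have hD : MeasurableSet {p : ℝ × ℝ | p.1 ^ 2 + p.2 ^ 2 < ρ} :=
    measurableSet_lt (by fun_prop) (by fun_prop)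
  have hR : MeasurableSet {r : ℝ | r ^ 2 < ρ} := measurableSet_lt (by fun_prop) (by fun_prop)
  rw [← lintegral_indicator_one (hD.inter hS), ← lintegral_comp_polarCoord_symm]
  have e1 : ∀ p ∈ polarCoord.target,
      ENNReal.ofReal p.1 • ({p : ℝ × ℝ | p.1 ^ 2 + p.2 ^ 2 < ρ} ∩ S).indicator (1 : ℝ × ℝ → ENNReal) (polarCoord.symm p)
      = (ENNReal.ofReal p.1 * {r : ℝ | r ^ 2 < ρ}.indicator 1 p.1) * I.indicator 1 p.2 := by
    rintro ⟨r, φ⟩ hp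
    simp only [polarCoord_target, Set.mem_prod, Set.mem_Ioi, Set.mem_Ioo] at hp
    have h' := h r φ hp.1 hp.2.1 hp.2.2
    have hq : (r * Real.cos φ) ^ 2 + (r * Real.sin φ) ^ 2 = r ^ 2 := by
      have := Real.sin_sq_add_cos_sq φ
      linear_combination r ^ 2 * this
    simp only [polarCoord_symm_apply, Set.indicator_apply, Set.mem_inter_iff, Set.mem_ofPred_eq, hq, h', smul_eq_mul, Pi.one_apply]
    by_cases a : r ^ 2 < ρ <;> by_cases b : φ ∈ I <;> simp [a, b]
  rw [setLIntegral_congr_fun polarCoord.open_target.measurableSet e1, polarCoord_target,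
    Measure.volume_eq_prod, ← Measure.prod_restrict]
  rw [lintegral_prod_mul (f := fun r : ℝ => ENNReal.ofReal r * {r : ℝ | r ^ 2 < ρ}.indicator 1 r)
    (g := fun φ : ℝ => I.indicator (1 : ℝ → ENNReal) φ) (by
    apply AEMeasurable.mul (by fun_prop)
    exact (measurable_one.indicator hR).aemeasurable) ((measurable_one.indicator hI).aemeasurable)]
  congr 1
  rw [lintegral_indicator_one hI, Measure.restrict_apply hI]

lemma sector2 (ρ : ℝ) :
    volume ({p : ℝ × ℝ | p.1 ^ 2 + p.2 ^ 2 < ρ} ∩ {p | 0 ≤ p.2 ∧ p.2 ≤ Real.sqrt 2 * p.1}) * ENNReal.ofReal (2 * Real.pi) =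
    ENNReal.ofReal (Real.arccos (1 / Real.sqrt 3)) * volume {p : ℝ × ℝ | p.1 ^ 2 + p.2 ^ 2 < ρ} := by
  have h1 := polar_vol ρ Set.univ MeasurableSet.univ Set.univ MeasurableSet.univ (by simp)
  have h2 := polar_vol ρ {p | 0 ≤ p.2 ∧ p.2 ≤ Real.sqrt 2 * p.1}
    wedge_meas
    (Set.Icc 0 (Real.arccos (1 / Real.sqrt 3))) measurableSet_Icc (by
      intro r φ hr ha hb
      rw [← sector_iff ha hb]
      simp only [Set.mem_ofPred_eq]
      rw [show Real.sqrt 2 * (r * Real.cos φ) = r * (Real.sqrt 2 * Real.cos φ) by ring,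
        mul_le_mul_iff_right₀ hr, mul_nonneg_iff_of_pos_left hr])
  have hI : Set.Icc 0 (Real.arccos (1 / Real.sqrt 3)) ∩ Set.Ioo (-Real.pi) Real.pi = Set.Icc 0 (Real.arccos (1 / Real.sqrt 3)) := by
    apply Set.inter_eq_left.mpr
    rintro x ⟨ha, hb⟩
    have hp := Real.pi_pos
    have hθ1 : Real.arccos (1 / Real.sqrt 3) ≤ Real.pi / 2 := by
      rw [Real.arccos_le_pi_div_two]; positivity
    constructor <;> linarith
  rw [hI] at h2
  simp only [Set.inter_univ, Set.univ_inter, Real.volume_Ioo, Real.volume_Icc] at h1 h2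
  rw [h1, h2]
  rw [show Real.pi - -Real.pi = 2 * Real.pi by ring, sub_zero]
  ring

lemma vol3 (ε : ℝ) (S : Set (ℝ × ℝ)) (hS : MeasurableSet S) :
    volume (eball (0 : Fin 3 → ℝ) ε ∩ {x | (x 1, x 2) ∈ S}) =
      ∫⁻ c : ℝ, volume ({p : ℝ × ℝ | p.1 ^ 2 + p.2 ^ 2 < ε ^ 2 - c ^ 2} ∩ S) := by
  have m1 := volume_preserving_piFinSuccAbove (fun _ : Fin 3 => ℝ) 0
  have m2 := (MeasurePreserving.id (volume : Measure ℝ)).prod (volume_preserving_finTwoArrow ℝ)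
  have m := m2.comp m1
  let T : Set (ℝ × ℝ × ℝ) := {q | q.2.1 ^ 2 + q.2.2 ^ 2 < ε ^ 2 - q.1 ^ 2} ∩ {q | q.2 ∈ S}
  have hT : MeasurableSet T :=
    (measurableSet_lt (by fun_prop) (by fun_prop)).inter (measurable_snd hS)
  have e := m.measure_preimage hT.nullMeasurableSet
  rw [Measure.volume_eq_prod, Measure.prod_apply hT] at e
  refine Eq.trans ?_ (e.trans ?_)
  · congr 1
    ext x
    simp [T, eball, Fin.sum_univ_three, MeasurableEquiv.finTwoArrow, lt_sub_iff_add_lt, add_comm, add_assoc, Fin.tail]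
  · rfl

lemma sector3 (ε : ℝ) :
    nuB ε {x | 0 ≤ x 2 ∧ x 2 ≤ Real.sqrt 2 * x 1} =
      Real.arccos (1 / Real.sqrt 3) / (2 * Real.pi) * nuB ε Set.univ := by
  have h1 := vol3 ε Set.univ MeasurableSet.univ
  have h2 := vol3 ε {p | 0 ≤ p.2 ∧ p.2 ≤ Real.sqrt 2 * p.1}
    wedge_meas
  have key : volume (eball (0 : Fin 3 → ℝ) ε ∩ {x | 0 ≤ x 2 ∧ x 2 ≤ Real.sqrt 2 * x 1}) * ENNReal.ofReal (2 * Real.pi)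
     = ENNReal.ofReal (Real.arccos (1 / Real.sqrt 3)) * volume (eball (0 : Fin 3 → ℝ) ε ∩ Set.univ) := by
    have h2' : volume (eball (0 : Fin 3 → ℝ) ε ∩ {x | 0 ≤ x 2 ∧ x 2 ≤ Real.sqrt 2 * x 1}) = _ := h2
    have h1' : volume (eball (0 : Fin 3 → ℝ) ε ∩ Set.univ) = _ := h1
    rw [h1', h2', ← lintegral_mul_const' _ _ ENNReal.ofReal_ne_top, ← lintegral_const_mul' _ _ ENNReal.ofReal_ne_top]
    simp only [sector2, Set.inter_univ]
  have := congrArg ENNReal.toReal key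
  rw [ENNReal.toReal_mul, ENNReal.toReal_mul, ENNReal.toReal_ofReal (by positivity), ENNReal.toReal_ofReal (Real.arccos_nonneg _)] at this
  unfold nuB
  have hp := Real.pi_pos
  field_simp
  linarith

lemma nu_congr {ε : ℝ} {P Q : (Fin 3 → ℝ) → Prop} (h : ∀ x, P x ↔ Q x) :
    nuB ε {x | P x} = nuB ε {x | Q x} := by
  have : P = Q := funext fun x => propext (h x)
  rw [this]

lemma nu_orth' (M : Matrix (Fin 3) (Fin 3) ℝ) (hdet : |M.det| = 1)
    (hM : ∀ x : Fin 3 → ℝ, ∑ i, (M.mulVec x i) ^ 2 = ∑ i, (x i) ^ 2) (ε : ℝ) (P : (Fin 3 → ℝ) → Prop) :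
    nuB ε {x | P (M.mulVec x)} = nuB ε {x | P x} := nu_orth M hdet hM ε {x | P x}

lemma nu_neg (ε : ℝ) (P : (Fin 3 → ℝ) → Prop) :
    nuB ε {x | P (-x)} = nuB ε {x | P x} := by
  have e : ∀ x : Fin 3 → ℝ, !![-1,0,0;0,-1,0;0,0,(-1:ℝ)].mulVec x = -x := by
    intro x; ext i; fin_cases i <;> simp [Matrix.mulVec, dotProduct, Fin.sum_univ_three]
  rw [← nu_orth' !![-1,0,0;0,-1,0;0,0,-1] (by simp [Matrix.det_fin_three])
    (by intro x; rw [e]; simp) ε P]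
  simp only [e]

lemma nu_swap01 (ε : ℝ) (P : (Fin 3 → ℝ) → Prop) :
    nuB ε {x | P ![x 1, x 0, x 2]} = nuB ε {x | P x} := by
  have e : ∀ x : Fin 3 → ℝ, !![0,1,0;1,0,0;0,0,(1:ℝ)].mulVec x = ![x 1, x 0, x 2] := by
    intro x; ext i; fin_cases i <;> simp [Matrix.mulVec, dotProduct, Fin.sum_univ_three]
  rw [← nu_orth' !![0,1,0;1,0,0;0,0,1] (by simp [Matrix.det_fin_three])
    (by intro x; rw [e]; simp [Fin.sum_univ_three]; ring) ε P]
  simp only [e]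

lemma nu_swap12 (ε : ℝ) (P : (Fin 3 → ℝ) → Prop) :
    nuB ε {x | P ![x 0, x 2, x 1]} = nuB ε {x | P x} := by
  have e : ∀ x : Fin 3 → ℝ, !![1,0,0;0,0,1;0,1,(0:ℝ)].mulVec x = ![x 0, x 2, x 1] := by
    intro x; ext i; fin_cases i <;> simp [Matrix.mulVec, dotProduct, Fin.sum_univ_three]
  rw [← nu_orth' !![1,0,0;0,0,1;0,1,0] (by simp [Matrix.det_fin_three])
    (by intro x; rw [e]; simp [Fin.sum_univ_three]; ring) ε P]
  simp only [e]

lemma nu_flip0 (ε : ℝ) (P : (Fin 3 → ℝ) → Prop) :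
    nuB ε {x | P ![-x 0, x 1, x 2]} = nuB ε {x | P x} := by
  have e : ∀ x : Fin 3 → ℝ, !![-1,0,0;0,1,0;0,0,(1:ℝ)].mulVec x = ![-x 0, x 1, x 2] := by
    intro x; ext i; fin_cases i <;> simp [Matrix.mulVec, dotProduct, Fin.sum_univ_three]
  rw [← nu_orth' !![-1,0,0;0,1,0;0,0,1] (by simp [Matrix.det_fin_three])
    (by intro x; rw [e]; simp [Fin.sum_univ_three]) ε P]
  simp only [e]

lemma nu_rot (ε : ℝ) (P : (Fin 3 → ℝ) → Prop) :
    nuB ε {x | P ![(x 0 - x 1) / Real.sqrt 2, x 2, (-x 0 - x 1) / Real.sqrt 2]} = nuB ε {x | P x} := by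
  have h2 : Real.sqrt 2 ^ 2 = 2 := Real.sq_sqrt (by norm_num)
  have hp : 0 < Real.sqrt 2 := by positivity
  have e : ∀ x : Fin 3 → ℝ, !![1 / Real.sqrt 2, - 1 / Real.sqrt 2,0;0,0,1;-1 / Real.sqrt 2,-1 / Real.sqrt 2,(0:ℝ)].mulVec x
      = ![(x 0 - x 1) / Real.sqrt 2, x 2, (-x 0 - x 1) / Real.sqrt 2] := by
    intro x; ext i; fin_cases i <;> simp [Matrix.mulVec, dotProduct, Fin.sum_univ_three] <;> ring
  rw [← nu_orth' !![1 / Real.sqrt 2, - 1 / Real.sqrt 2,0;0,0,1;-1 / Real.sqrt 2,-1 / Real.sqrt 2,(0:ℝ)] 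
    (by
      have : (!![1 / Real.sqrt 2, - 1 / Real.sqrt 2,0;0,0,1;-1 / Real.sqrt 2,-1 / Real.sqrt 2,(0:ℝ)]).det = 1 := by
        simp only [Matrix.det_fin_three]
        simp
        field_simp
        linarith
      rw [this]; simp)
    (by intro x; rw [e]; simp [Fin.sum_univ_three]; field_simp; rw [h2]; ring) ε P]
  simp only [e]

lemma nu_split_c {ε : ℝ} (hε : 0 < ε) (i : Fin 3) (P : (Fin 3 → ℝ) → Prop) :
    nuB ε {x | P x} = nuB ε {x | P x ∧ 0 ≤ x i} + nuB ε {x | P x ∧ x i ≤ 0} := by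
  have := nu_split hε (Pi.single i 1) i (by simp) {x | P x}
  simp [Pi.single_apply] at this
  exact this

lemma nu_split_s {ε : ℝ} (hε : 0 < ε) (P : (Fin 3 → ℝ) → Prop) :
    nuB ε {x | P x} = nuB ε {x | P x ∧ 0 ≤ x 0 + x 1 + x 2} + nuB ε {x | P x ∧ x 0 + x 1 + x 2 ≤ 0} := by
  have := nu_split hε (fun _ => 1) 0 (by simp) {x | P x}
  simp [Fin.sum_univ_three] at this
  exact this

lemma nu_half0 {ε : ℝ} (hε : 0 < ε) (p : Prop) (P : (Fin 3 → ℝ) → Prop)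
    (hP : ∀ x, P ![-x 0, x 1, x 2] ↔ P x) :
    nuB ε {x | P x ∧ (p → 0 ≤ x 0)} = (if p then 1 / 2 else 1) * nuB ε {x | P x} := by
  by_cases h : p
  · simp only [h, if_true, true_imp_iff]
    have h1 := nu_split_c hε 0 P
    have h2 := nu_flip0 ε (fun x => P x ∧ 0 ≤ x 0)
    simp [hP] at h2
    linarith
  · simp [h]

noncomputable def hw (p : Prop) : ℝ := if p then 1 / 2 else 1

lemma nu_oct {ε : ℝ} (hε : 0 < ε) (p q r : Prop) :
    nuB ε {x | (p → 0 ≤ x 0) ∧ (q → 0 ≤ x 1) ∧ (r → 0 ≤ x 2)} = (hw p * hw q * hw r) * nuB ε Set.univ := by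
  have h1 := nu_half0 hε p (fun x => (q → 0 ≤ x 1) ∧ (r → 0 ≤ x 2)) (by simp)
  have h2 := nu_swap01 ε (fun x => (r → 0 ≤ x 2) ∧ (q → 0 ≤ x 0))
  have h3 := nu_half0 hε q (fun x => (r → 0 ≤ x 2)) (by simp)
  have h4 := nu_swap12 ε (fun x => (r → 0 ≤ x 1))
  have h5 := nu_swap01 ε (fun x => (r → 0 ≤ x 0))
  have h6 := nu_half0 hε r (fun x => True) (by simp)
  simp only [Matrix.cons_val, true_and] at h2 h3 h4 h5 h6
  have h7 : nuB ε {x | True} = nuB ε Set.univ := rfl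
  rw [nu_congr (Q := fun x => ((q → 0 ≤ x 1) ∧ (r → 0 ≤ x 2)) ∧ (p → 0 ≤ x 0)) (by intro x; tauto), h1,
    nu_congr (Q := fun x => (r → 0 ≤ x 2) ∧ (q → 0 ≤ x 1)) (by intro x; tauto), h2, h3, h4, h5, h6, h7]
  unfold hw
  ring

lemma nu_halfspace {ε : ℝ} (hε : 0 < ε) :
    nuB ε {x | x 0 + x 1 + x 2 ≤ 0} = 1 / 2 * nuB ε Set.univ := by
  have h1 := nu_split_s hε (fun _ => True)
  have h2 := nu_neg ε (fun x => x 0 + x 1 + x 2 ≤ 0)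
  have h3 := nu_congr (ε := ε) (P := fun x => (-x) 0 + (-x) 1 + (-x) 2 ≤ 0) (Q := fun x => 0 ≤ x 0 + x 1 + x 2) (by
    intro x; simp only [Pi.neg_apply]; constructor <;> intro h <;> linarith)
  have h7 : nuB ε {x | True} = nuB ε Set.univ := rfl
  simp only [true_and] at h1
  linarith

noncomputable def wdg : ℝ := Real.arccos (1 / Real.sqrt 3) / (2 * Real.pi)

lemma nu_wedge1 (ε : ℝ) :
    nuB ε {x | 0 ≤ x 1 ∧ x 0 + x 1 + x 2 ≤ 0} = wdg * nuB ε Set.univ := by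
  rw [← nu_rot]
  unfold wdg
  rw [← sector3]
  apply nu_congr
  intro x
  have h2 : Real.sqrt 2 ^ 2 = 2 := Real.sq_sqrt (by norm_num)
  have hp : 0 < Real.sqrt 2 := by positivity
  have : (x 0 - x 1) / Real.sqrt 2 + x 2 + (-x 0 - x 1) / Real.sqrt 2 = x 2 - Real.sqrt 2 * x 1 := by
    field_simp; linear_combination x 1 * h2
  simp [this]

lemma nu_wedge0 (ε : ℝ) :
    nuB ε {x | 0 ≤ x 0 ∧ x 0 + x 1 + x 2 ≤ 0} = wdg * nuB ε Set.univ := by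
  rw [← nu_wedge1, ← nu_swap01]
  simp [add_comm, add_left_comm, add_assoc]

lemma nu_wedge2 (ε : ℝ) :
    nuB ε {x | 0 ≤ x 2 ∧ x 0 + x 1 + x 2 ≤ 0} = wdg * nuB ε Set.univ := by
  rw [← nu_wedge1, ← nu_swap12]
  simp [add_comm, add_left_comm, add_assoc]

lemma nu_vert01 {ε : ℝ} (hε : 0 < ε) :
    nuB ε {x | 0 ≤ x 0 ∧ 0 ≤ x 1 ∧ x 0 + x 1 + x 2 ≤ 0} = (wdg - 1 / 8) * nuB ε Set.univ := by
  have q := nu_oct hε True True False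
  simp [hw] at q
  have a1 := nu_split_s hε (fun x => 0 ≤ x 0 ∧ 0 ≤ x 1)
  have a2 := nu_neg ε (fun x => (0 ≤ x 0 ∧ 0 ≤ x 1) ∧ 0 ≤ x 0 + x 1 + x 2)
  have a3 := nu_split_c hε 1 (fun x => x 0 ≤ 0 ∧ x 0 + x 1 + x 2 ≤ 0)
  have a4 := nu_split_c hε 0 (fun x => 0 ≤ x 1 ∧ x 0 + x 1 + x 2 ≤ 0)
  have a5 := nu_split_c hε 0 (fun x => x 0 + x 1 + x 2 ≤ 0)
  have b1 := nu_wedge1 ε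
  have b0 := nu_wedge0 ε
  have b := nu_halfspace hε
  have c1 := nu_congr (ε := ε) (P := fun x => (0 ≤ (-x) 0 ∧ 0 ≤ (-x) 1) ∧ 0 ≤ (-x) 0 + (-x) 1 + (-x) 2)
    (Q := fun x => (x 0 ≤ 0 ∧ x 0 + x 1 + x 2 ≤ 0) ∧ x 1 ≤ 0) (by
      intro x; simp only [Pi.neg_apply]
      constructor <;> rintro ⟨⟨h, h'⟩, h''⟩ <;> refine ⟨⟨?_, ?_⟩, ?_⟩ <;> linarith)
  have c2 := nu_congr (ε := ε) (P := fun x => (x 0 ≤ 0 ∧ x 0 + x 1 + x 2 ≤ 0) ∧ 0 ≤ x 1)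
    (Q := fun x => (0 ≤ x 1 ∧ x 0 + x 1 + x 2 ≤ 0) ∧ x 0 ≤ 0) (by intro x; tauto)
  have c3 := nu_congr (ε := ε) (P := fun x => (0 ≤ x 0 ∧ 0 ≤ x 1) ∧ x 0 + x 1 + x 2 ≤ 0)
    (Q := fun x => 0 ≤ x 0 ∧ 0 ≤ x 1 ∧ x 0 + x 1 + x 2 ≤ 0) (by intro x; tauto)
  have c4 := nu_congr (ε := ε) (P := fun x => (0 ≤ x 1 ∧ x 0 + x 1 + x 2 ≤ 0) ∧ 0 ≤ x 0)
    (Q := fun x => 0 ≤ x 0 ∧ 0 ≤ x 1 ∧ x 0 + x 1 + x 2 ≤ 0) (by intro x; tauto)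
  have c5 := nu_congr (ε := ε) (P := fun x => x 0 + x 1 + x 2 ≤ 0 ∧ 0 ≤ x 0)
    (Q := fun x => 0 ≤ x 0 ∧ x 0 + x 1 + x 2 ≤ 0) (by intro x; tauto)
  have c6 := nu_congr (ε := ε) (P := fun x => x 0 + x 1 + x 2 ≤ 0 ∧ x 0 ≤ 0)
    (Q := fun x => x 0 ≤ 0 ∧ x 0 + x 1 + x 2 ≤ 0) (by intro x; tauto)
  linarith

lemma nu_vert02 {ε : ℝ} (hε : 0 < ε) :
    nuB ε {x | 0 ≤ x 0 ∧ 0 ≤ x 2 ∧ x 0 + x 1 + x 2 ≤ 0} = (wdg - 1 / 8) * nuB ε Set.univ := by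
  rw [← nu_vert01 hε, ← nu_swap12]
  apply nu_congr
  intro x
  simp [add_comm, add_left_comm, add_assoc]

lemma nu_vert12 {ε : ℝ} (hε : 0 < ε) :
    nuB ε {x | 0 ≤ x 1 ∧ 0 ≤ x 2 ∧ x 0 + x 1 + x 2 ≤ 0} = (wdg - 1 / 8) * nuB ε Set.univ := by
  rw [← nu_vert02 hε, ← nu_swap01]
  apply nu_congr
  intro x
  simp [add_comm, add_left_comm, add_assoc]

/-- weights on the slanted face, by number of vanishing coordinates -/
noncomputable def sw (k : ℕ) : ℝ := if k = 0 then 1 / 2 else if k = 1 then wdg else wdg - 1 / 8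

noncomputable def zc (p : Prop) : ℕ := if p then 1 else 0

lemma nu_slant {ε : ℝ} (hε : 0 < ε) (p q r : Prop) (h : ¬ (p ∧ q ∧ r)) :
    nuB ε {x | (p → 0 ≤ x 0) ∧ (q → 0 ≤ x 1) ∧ (r → 0 ≤ x 2) ∧ x 0 + x 1 + x 2 ≤ 0} =
      sw (zc p + zc q + zc r) * nuB ε Set.univ := by
  by_cases hp : p <;> by_cases hq : q <;> by_cases hr : r <;>
    simp only [hp, hq, hr, zc, sw, true_imp_iff, false_imp_iff, true_and, if_true, if_false]
  · exact absurd ⟨hp, hq, hr⟩ h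
  · simpa using nu_vert01 hε
  · simpa using nu_vert02 hε
  · simpa using nu_wedge0 ε
  · simpa using nu_vert12 hε
  · simpa using nu_wedge1 ε
  · simpa using nu_wedge2 ε
  · simpa using nu_halfspace hε

lemma sa_val {c : Fin 3 → ℝ} {S T : Set (Fin 3 → ℝ)} {ω κ δ : ℝ} (hs : saTendsto S c ω) (hδ : 0 < δ)
    (h : ∀ x : Fin 3 → ℝ, (∀ i, |x i| < δ) → (x + c ∈ S ↔ x ∈ T))
    (hT : ∀ ε, 0 < ε → nuB ε T = κ * nuB ε Set.univ) : ω = κ := by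
  refine tendsto_nhds_unique hs (tendsto_const_nhds.congr' ?_)
  filter_upwards [Ioo_mem_nhdsGT hδ] with ε hε
  have hp := eball_pos_s12 c hε.1
  have e1 : (volume (eball c ε)).toReal = nuB ε Set.univ := by
    have := vol_translate c ε Set.univ
    simpa using this
  have e2 : nuB ε {x | x + c ∈ S} = nuB ε T := by
    unfold nuB
    congr 2
    ext x
    simp only [Set.mem_inter_iff, Set.mem_ofPred_eq]
    apply and_congr_right
    intro hx
    apply h
    intro i
    have := eball_sub 0 hε.1 hx
    rw [mem_ball_iff_norm, sub_zero, pi_norm_lt_iff hε.1] at this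
    exact (this i).trans hε.2
  rw [vol_translate, e2, hT ε hε.1, ← e1]
  field_simp

lemma mem_simplex {t : ℝ} (ht : 0 < t) (x : Fin 3 → ℝ) :
    x ∈ t • stdSimplex3 ↔ 0 ≤ x 0 ∧ 0 ≤ x 1 ∧ 0 ≤ x 2 ∧ x 0 + x 1 + x 2 ≤ t := by
  have base : ∀ y : Fin 3 → ℝ, y ∈ stdSimplex3 ↔ 0 ≤ y 0 ∧ 0 ≤ y 1 ∧ 0 ≤ y 2 ∧ y 0 + y 1 + y 2 ≤ 1 := by
    intro y
    constructor
    · intro hy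
      have hc : Convex ℝ {y : Fin 3 → ℝ | 0 ≤ y 0 ∧ 0 ≤ y 1 ∧ 0 ≤ y 2 ∧ y 0 + y 1 + y 2 ≤ 1} := by
        rintro u ⟨u0, u1, u2, u3⟩ v ⟨v0, v1, v2, v3⟩ a b ha hb hab
        simp only [Set.mem_ofPred_eq, Pi.add_apply, Pi.smul_apply, smul_eq_mul]
        refine ⟨by positivity, by positivity, by positivity, ?_⟩
        nlinarith
      refine convexHull_min ?_ hc hy
      rintro z (rfl | rfl | rfl | rfl) <;> simp
    · rintro ⟨h0, h1, h2, h3⟩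
      have := (convex_convexHull ℝ {![(0:ℝ),0,0], ![1,0,0], ![0,1,0], ![0,0,1]}).sum_mem (t := Finset.univ)
        (w := ![1 - y 0 - y 1 - y 2, y 0, y 1, y 2]) (z := ![![(0:ℝ),0,0], ![1,0,0], ![0,1,0], ![0,0,1]])
        (by intro i _; fin_cases i <;> simp <;> linarith) (by simp [Fin.sum_univ_four]; ring)
        (by intro i _; apply subset_convexHull; fin_cases i <;> simp)
      have e : y = ∑ i, ![1 - y 0 - y 1 - y 2, y 0, y 1, y 2] i • ![![(0:ℝ),0,0], ![1,0,0], ![0,1,0], ![0,0,1]] i := by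
        ext i
        fin_cases i <;> simp [Fin.sum_univ_four]
      rw [e]
      exact this
  rw [Set.mem_smul_set_iff_inv_smul_mem₀ ht.ne', base]
  simp only [Pi.smul_apply, smul_eq_mul]
  have hi : 0 < t⁻¹ := by positivity
  rw [mul_nonneg_iff_of_pos_left hi, mul_nonneg_iff_of_pos_left hi, mul_nonneg_iff_of_pos_left hi,
    ← mul_add, ← mul_add, inv_mul_le_iff₀ ht, mul_one]


lemma nu_empty (ε : ℝ) : nuB ε ∅ = 0 * nuB ε Set.univ := by simp [nuB]

lemma om_neg {t : ℝ} (ht : 0 < t) {n : Fin 3 → ℤ} {w : ℝ}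
    (h : saTendsto (t • stdSimplex3) (fun i => (n i : ℝ)) w) (i : Fin 3) (hi : n i < 0) : w = 0 := by
  refine sa_val h (δ := 1) (T := ∅) one_pos ?_ (fun ε _ => nu_empty ε)
  intro x hx
  rw [mem_simplex ht]
  simp only [Pi.add_apply, Set.mem_empty_iff_false, iff_false]
  have h1 : (n i : ℝ) ≤ -1 := by exact_mod_cast (show n i ≤ -1 by omega)
  have h2 := (abs_lt.mp (hx i)).2
  rintro ⟨h3, h4, h5, -⟩
  fin_cases i <;> simp at h1 h2 <;> linarith

lemma om_big {t : ℝ} (ht : 0 < t) {n : Fin 3 → ℤ} {w : ℝ}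
    (h : saTendsto (t • stdSimplex3) (fun i => (n i : ℝ)) w) (hi : t < n 0 + n 1 + n 2) : w = 0 := by
  refine sa_val h (δ := ((n 0 + n 1 + n 2 : ℝ) - t) / 3) (T := ∅) (by linarith) ?_ (fun ε _ => nu_empty ε)
  intro x hx
  rw [mem_simplex ht]
  simp only [Pi.add_apply, Set.mem_empty_iff_false, iff_false]
  have h0 := (abs_lt.mp (hx 0)).1
  have h1 := (abs_lt.mp (hx 1)).1
  have h2 := (abs_lt.mp (hx 2)).1
  rintro ⟨-, -, -, h3⟩
  linarith

lemma coord_aux (a : ℕ) (x : ℝ) (hx : |x| < 1) : 0 ≤ x + (a : ℝ) ↔ (a = 0 → 0 ≤ x) := by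
  by_cases h : a = 0
  · simp [h]
  · have h1 : (1 : ℝ) ≤ a := by exact_mod_cast Nat.one_le_iff_ne_zero.mpr h
    have h2 := (abs_lt.mp hx).1
    simp only [h, false_imp_iff, iff_true]
    linarith

lemma om_in {t : ℝ} (ht : 0 < t) (a b c : ℕ) {w : ℝ}
    (h : saTendsto (t • stdSimplex3) (fun i => ((![a, b, c] : Fin 3 → ℤ) i : ℝ)) w)
    (hi : (a + b + c : ℝ) < t) : w = (1 / 2) ^ (zc (a = 0) + zc (b = 0) + zc (c = 0)) := by
  have key : w = hw (a = 0) * hw (b = 0) * hw (c = 0) := by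
    refine sa_val h (δ := min 1 ((t - (a + b + c)) / 3)) (by apply lt_min one_pos; linarith) ?_
      (fun ε hε => nu_oct hε _ _ _)
    intro x hx
    rw [mem_simplex ht]
    have hx1 : ∀ i, |x i| < 1 := fun i => (hx i).trans_le (min_le_left _ _)
    have hx2 : ∀ i, x i < (t - (a + b + c)) / 3 := fun i => (abs_lt.mp ((hx i).trans_le (min_le_right _ _))).2
    have h0 := hx2 0
    have h1 := hx2 1
    have h2 := hx2 2
    simp only [Pi.add_apply, Matrix.cons_val, Int.cast_natCast, Set.mem_ofPred_eq]
    rw [coord_aux a _ (hx1 0), coord_aux b _ (hx1 1), coord_aux c _ (hx1 2)]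
    have h3 : x 0 + (a : ℝ) + (x 1 + b) + (x 2 + c) ≤ t := by linarith
    tauto
  rw [key, pow_add, pow_add]
  unfold hw zc
  congr 1
  · congr 1 <;> split_ifs <;> simp
  · split_ifs <;> simp

lemma om_top {t : ℝ} (ht : 0 < t) (a b c : ℕ) {w : ℝ}
    (h : saTendsto (t • stdSimplex3) (fun i => ((![a, b, c] : Fin 3 → ℤ) i : ℝ)) w)
    (hi : (a + b + c : ℝ) = t) : w = sw (zc (a = 0) + zc (b = 0) + zc (c = 0)) := by
  refine sa_val h one_pos ?_ (fun ε hε => nu_slant hε _ _ _ ?_)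
  · intro x hx
    rw [mem_simplex ht]
    simp only [Pi.add_apply, Matrix.cons_val, Int.cast_natCast, Set.mem_ofPred_eq]
    rw [coord_aux a _ (hx 0), coord_aux b _ (hx 1), coord_aux c _ (hx 2)]
    have h3 : x 0 + (a : ℝ) + (x 1 + b) + (x 2 + c) ≤ t ↔ x 0 + x 1 + x 2 ≤ 0 := by
      constructor <;> intro h <;> linarith
    rw [h3]
  · rintro ⟨rfl, rfl, rfl⟩
    simp at hi
    linarith


open Finset.Nat in
lemma lay1 (G : ℕ → ℝ) (j m : ℕ) :
    ∑ q ∈ Finset.HasAntidiagonal.antidiagonal m, G (j + zc (q.2 = 0)) = G (j + 1) + m * G j := by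
  induction m with
  | zero => simp [zc]
  | succ m ih => rw [sum_antidiagonal_succ, ih]; simp [zc]; ring

open Finset.Nat in
lemma lay2 (G : ℕ → ℝ) (j m : ℕ) :
    ∑ q ∈ Finset.HasAntidiagonal.antidiagonal (m + 1), G (j + zc (q.1 = 0) + zc (q.2 = 0)) = 2 * G (j + 1) + m * G j := by
  rw [sum_antidiagonal_succ]
  have := lay1 G j m
  simp [zc] at this ⊢
  rw [this]; ring

open Finset.Nat in
lemma lay3 (G : ℕ → ℝ) (m : ℕ) :
    ∑ p ∈ Finset.HasAntidiagonal.antidiagonal m, ∑ q ∈ Finset.HasAntidiagonal.antidiagonal p.2, G (0 + zc (q.1 = 0) + zc (q.2 = 0)) =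
      G 2 + 2 * m * G 1 + m * (m - 1) / 2 * G 0 := by
  induction m with
  | zero => simp [zc]
  | succ m ih =>
    rw [sum_antidiagonal_succ, ih]
    simp only [lay2]
    push_cast; ring_nf

open Finset.Nat in
lemma lay (G : ℕ → ℝ) (m : ℕ) :
    ∑ p ∈ Finset.HasAntidiagonal.antidiagonal (m + 1), ∑ q ∈ Finset.HasAntidiagonal.antidiagonal p.2, G (zc (p.1 = 0) + zc (q.1 = 0) + zc (q.2 = 0)) =
      3 * G 2 + 3 * m * G 1 + m * (m - 1) / 2 * G 0 := by
  rw [sum_antidiagonal_succ]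
  have h1 := lay3 G m
  have h2 := lay2 G (zc True) m
  have z0 : ∀ n : ℕ, zc (n + 1 = 0) = 0 := by simp [zc]
  have z1 : zc True = 1 := by simp [zc]
  simp only [z0, h1, h2]
  rw [z1]; ring

lemma layers (M : ℕ) :
    ∑ k ∈ Finset.range (M + 1), ∑ p ∈ Finset.HasAntidiagonal.antidiagonal k, ∑ q ∈ Finset.HasAntidiagonal.antidiagonal p.2,
      ((1 / 2 : ℝ)) ^ (zc (p.1 = 0) + zc (q.1 = 0) + zc (q.2 = 0)) =
      (M : ℝ) ^ 3 / 6 + (M : ℝ) ^ 2 / 4 + (M : ℝ) / 3 + 1 / 8 := by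
  induction M with
  | zero => simp [zc]; norm_num
  | succ M ih =>
    rw [Finset.sum_range_succ, ih, lay (fun z => (1 / 2 : ℝ) ^ z) M]
    push_cast; ring

lemma tsum_layers (ω : (Fin 3 → ℤ) → ℝ) (N : ℕ)
    (h : ∀ n : Fin 3 → ℤ, ¬ (0 ≤ n 0 ∧ 0 ≤ n 1 ∧ 0 ≤ n 2 ∧ n 0 + n 1 + n 2 ≤ N) → ω n = 0) :
    ∑' n, ω n = ∑ k ∈ Finset.range (N + 1), ∑ p ∈ Finset.HasAntidiagonal.antidiagonal k, ∑ q ∈ Finset.HasAntidiagonal.antidiagonal p.2,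
      ω ![(p.1 : ℤ), (q.1 : ℤ), (q.2 : ℤ)] := by
  let i : (Σ _ : ℕ, Σ _ : ℕ × ℕ, ℕ × ℕ) → (Fin 3 → ℤ) := fun s => ![(s.2.1.1 : ℤ), (s.2.2.1 : ℤ), (s.2.2.2 : ℤ)]
  let S : Finset (Σ _ : ℕ, Σ _ : ℕ × ℕ, ℕ × ℕ) := (Finset.range (N + 1)).sigma
    (fun k => (Finset.HasAntidiagonal.antidiagonal k).sigma (fun p => Finset.HasAntidiagonal.antidiagonal p.2))
  rw [tsum_eq_sum (s := S.image i), Finset.sum_image]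
  · simp only [S, Finset.sum_sigma, i]
  · rintro ⟨k, ⟨p1, p2⟩, ⟨q1, q2⟩⟩ hs ⟨k', ⟨p1', p2'⟩, ⟨q1', q2'⟩⟩ hs' heq
    have h0 := congrFun heq 0
    have h1 := congrFun heq 1
    have h2 := congrFun heq 2
    simp [S, i] at hs hs' h0 h1 h2
    obtain ⟨_, e1, e2⟩ := hs
    obtain ⟨_, e3, e4⟩ := hs'
    subst h0 h1 h2
    subst e2 e4
    subst e1 e3
    rfl
  · intro n hn
    apply h
    rintro ⟨h0, h1, h2, h3⟩
    apply hn
    rw [Finset.mem_image]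
    refine ⟨⟨(n 0).toNat + ((n 1).toNat + (n 2).toNat), ⟨(n 0).toNat, (n 1).toNat + (n 2).toNat⟩, ⟨(n 1).toNat, (n 2).toNat⟩⟩, ?_, ?_⟩
    · simp [S]; omega
    · ext j; fin_cases j <;> simp [i, h0, h1, h2]

/-- The solid angle sum of the standard simplex `Δ ⊂ ℝ³` for all positive real dilates `t`. -/
theorem solid_angle_sum_standard_simplex (t : ℝ) (ht : 0 < t)
    (ω : (Fin 3 → ℤ) → ℝ)
    (hω : ∀ n : Fin 3 → ℤ, saTendsto (t • stdSimplex3) (fun i => (n i : ℝ)) (ω n)) :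
    ∑' n : Fin 3 → ℤ, ω n =
      (1/6) * t^3 - (1/2) * B1bar t * t^2 +
        ((1/2) * B2bar t +
          ((3 / (2 * Real.pi)) * Real.arccos (1 / Real.sqrt 3) - 3/4) * indZ t + 1/4) * t -
        B1bar t * ((1/6) * B2bar t + 2/9) := by
  obtain ⟨N, hN1, hN2⟩ : ∃ N : ℕ, (N : ℝ) ≤ t ∧ t < N + 1 :=
    ⟨⌊t⌋₊, Nat.floor_le ht.le, Nat.lt_floor_add_one t⟩
  rw [tsum_layers ω N]
  swap
  · intro n hn
    by_cases h : ∃ i, n i < 0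
    · obtain ⟨i, hi⟩ := h
      exact om_neg ht (hω n) i hi
    · push Not at h
      apply om_big ht (hω n)
      have : (N : ℤ) + 1 ≤ n 0 + n 1 + n 2 := by
        by_contra h'
        exact hn ⟨h 0, h 1, h 2, by omega⟩
      have : (N : ℝ) + 1 ≤ n 0 + n 1 + n 2 := by exact_mod_cast this
      linarith
  have hlow : ∀ M : ℕ, (M : ℝ) < t → ∑ k ∈ Finset.range (M + 1), ∑ p ∈ Finset.HasAntidiagonal.antidiagonal k,
      ∑ q ∈ Finset.HasAntidiagonal.antidiagonal p.2, ω ![(p.1 : ℤ), (q.1 : ℤ), (q.2 : ℤ)] =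
      (M : ℝ) ^ 3 / 6 + (M : ℝ) ^ 2 / 4 + (M : ℝ) / 3 + 1 / 8 := by
    intro M hM
    rw [← layers]
    refine Finset.sum_congr rfl fun k hk => Finset.sum_congr rfl fun p hp => Finset.sum_congr rfl fun q hq => ?_
    apply om_in ht _ _ _ (hω _)
    simp only [Finset.mem_range, Finset.HasAntidiagonal.mem_antidiagonal] at hk hp hq
    have : p.1 + q.1 + q.2 ≤ M := by omega
    have : (p.1 + q.1 + q.2 : ℝ) ≤ M := by exact_mod_cast this
    linarith
  by_cases hNt : (N : ℝ) = t
  · have hN0 : N ≠ 0 := by rintro rfl; simp at hNt; linarith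
    obtain ⟨M, rfl⟩ := Nat.exists_eq_succ_of_ne_zero hN0
    have hZ : ∃ n : ℤ, t = n := ⟨(M + 1 : ℕ), by rw [← hNt]; simp⟩
    have hf : Int.fract t = 0 := by rw [← hNt]; exact Int.fract_natCast _
    rw [Finset.sum_range_succ, hlow M (by rw [← hNt]; simp)]
    have htop : ∑ p ∈ Finset.HasAntidiagonal.antidiagonal (M + 1),
      ∑ q ∈ Finset.HasAntidiagonal.antidiagonal p.2, ω ![(p.1 : ℤ), (q.1 : ℤ), (q.2 : ℤ)] =
       3 * sw 2 + 3 * M * sw 1 + M * (M - 1) / 2 * sw 0 := by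
      rw [← lay]
      refine Finset.sum_congr rfl fun p hp => Finset.sum_congr rfl fun q hq => ?_
      apply om_top ht _ _ _ (hω _)
      simp only [Finset.HasAntidiagonal.mem_antidiagonal] at hp hq
      rw [← hNt]
      have : p.1 + q.1 + q.2 = M + 1 := by omega
      exact_mod_cast this
    rw [htop]
    simp only [B1bar, B2bar, indZ, hZ, if_true, hf, sw, wdg]
    have ht' : t = M + 1 := by rw [← hNt]; push_cast; rfl
    rw [ht']
    have hp := Real.pi_pos
    norm_num
    field_simp
    ring
  · have hlt : (N : ℝ) < t := lt_of_le_of_ne hN1 hNt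
    have hfl : ⌊t⌋ = (N : ℤ) := Int.floor_eq_iff.mpr ⟨by exact_mod_cast hN1, by exact_mod_cast hN2⟩
    have hZ : ¬ ∃ n : ℤ, t = n := by
      rintro ⟨n, rfl⟩
      simp at hfl
      apply hNt
      rw [hfl]; simp
    have hf : Int.fract t = t - N := by rw [Int.fract, hfl]; simp
    rw [hlow N hlt]
    simp only [B1bar, B2bar, indZ, hZ, if_false, hf]
    ring
end
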